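/- arXiv:2005.04371 — 2 statements merged into one kernel-verified Lean document; each statement's English description precedes it below -/
import Mathlib

section
/- The arithmetic means of the negative continued fraction digits converge to 3 in measure; that is, for every ε > 0, the Lebesgue measure of the set {x ∈ (0,1) irrational : |(1/n) ∑_{k=1}^{n} a'_k(x) − 3| > ε} tends to 0 as n → ∞. -/
open MeasureTheory Filter Real

/-- The negative continued fraction map `T(y) = -1/y - ⌊-1/y⌋` (with `T 0 = 0`). -/
noncomputable def negT (y : ℝ) : ℝ := Int.fract (-1 / y)

/-- The `n`-th negative continued fraction digit `a'_n(x) = ⌈1 / T^{n-1}(1-x)⌉`. -/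
noncomputable def negDigit (x : ℝ) (n : ℕ) : ℕ := (⌈1 / negT^[n - 1] (1 - x)⌉).toNat

/-- The probability `u / ((u + k) (u + k + 1))` of the digit `k + 2` in state `u`. -/
noncomputable def digitWeight (u : ℝ) (k : ℕ) : ℝ := u / ((u + k) * (u + k + 1))

/-- The mean of `G` with respect to the weights `digitWeight u`. -/
noncomputable def digitMean (u : ℝ) (G : ℕ → ℝ) : ℝ := ∑' k, digitWeight u k * G k

/-- A real sequence is bounded in absolute value. -/
def AbsBounded (G : ℕ → ℝ) : Prop := ∃ C, ∀ k, |G k| ≤ C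

namespace AbsBounded

variable {F G : ℕ → ℝ}

lemma const (c : ℝ) : AbsBounded fun _ => c := ⟨|c|, fun _ => le_rfl⟩

lemma add (hF : AbsBounded F) (hG : AbsBounded G) : AbsBounded fun k => F k + G k := by
  obtain ⟨C, hC⟩ := hF
  obtain ⟨D, hD⟩ := hG
  exact ⟨C + D, fun k => (abs_add_le _ _).trans (add_le_add (hC k) (hD k))⟩

lemma mul (hF : AbsBounded F) (hG : AbsBounded G) : AbsBounded fun k => F k * G k := by
  obtain ⟨C, hC⟩ := hF
  obtain ⟨D, hD⟩ := hG
  refine ⟨C * D, fun k => ?_⟩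
  rw [abs_mul]
  exact mul_le_mul (hC k) (hD k) (abs_nonneg _) ((abs_nonneg _).trans (hC k))

lemma neg (hF : AbsBounded F) : AbsBounded fun k => -F k := by
  obtain ⟨C, hC⟩ := hF
  exact ⟨C, fun k => by rw [abs_neg]; exact hC k⟩

lemma sub (hF : AbsBounded F) (hG : AbsBounded G) : AbsBounded fun k => F k - G k := by
  simpa only [sub_eq_add_neg] using hF.add hG.neg

lemma pow (hF : AbsBounded F) (n : ℕ) : AbsBounded fun k => F k ^ n := by
  induction n with
  | zero => simpa using const 1
  | succ n ih => simpa only [pow_succ] using ih.mul hF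

end AbsBounded

lemma absBounded_indicator (p : ℕ → Prop) [DecidablePred p] :
    AbsBounded fun k => if p k then 1 else 0 :=
  ⟨1, fun k => by dsimp only; split_ifs <;> simp⟩

section digitMean

variable {u : ℝ} {F G : ℕ → ℝ}

lemma digitWeight_nonneg (hu : 0 < u) (k : ℕ) : 0 ≤ digitWeight u k := by
  unfold digitWeight; positivity

lemma digitWeight_eq_sub (hu : 0 < u) (k : ℕ) :
    digitWeight u k = u / (u + k) - u / (u + (k + 1 : ℕ)) := by
  unfold digitWeight
  push_cast
  field_simp
  ring

lemma tendsto_div_add_natCast (u : ℝ) :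
    Tendsto (fun k : ℕ => u / (u + k)) atTop (nhds 0) :=
  tendsto_const_nhds.div_atTop
    (tendsto_atTop_add_const_left _ _ tendsto_natCast_atTop_atTop)

lemma hasSum_digitWeight (hu : 0 < u) : HasSum (digitWeight u) 1 := by
  rw [hasSum_iff_tendsto_nat_of_nonneg (digitWeight_nonneg hu)]
  have h : ∀ n : ℕ, ∑ k ∈ Finset.range n, digitWeight u k = 1 - u / (u + n) := by
    intro n
    rw [Finset.sum_congr rfl fun k _ => digitWeight_eq_sub hu k,
      Finset.sum_range_sub' fun k : ℕ => u / (u + k)]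
    simp [hu.ne']
  simp_rw [h]
  simpa using (tendsto_div_add_natCast u).const_sub 1

lemma summable_digitWeight_mul (hu : 0 < u) (hG : AbsBounded G) :
    Summable fun k => digitWeight u k * G k := by
  obtain ⟨C, hC⟩ := hG
  refine Summable.of_norm_bounded ((hasSum_digitWeight hu).summable.mul_right C) fun k => ?_
  rw [norm_mul, Real.norm_of_nonneg (digitWeight_nonneg hu k), Real.norm_eq_abs]
  exact mul_le_mul_of_nonneg_left (hC k) (digitWeight_nonneg hu k)

lemma digitMean_const (hu : 0 < u) (c : ℝ) : digitMean u (fun _ => c) = c := by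
  unfold digitMean
  rw [tsum_mul_right, (hasSum_digitWeight hu).tsum_eq, one_mul]

lemma digitMean_add (hu : 0 < u) (hF : AbsBounded F) (hG : AbsBounded G) :
    digitMean u (fun k => F k + G k) = digitMean u F + digitMean u G := by
  unfold digitMean
  rw [← (summable_digitWeight_mul hu hF).tsum_add (summable_digitWeight_mul hu hG)]
  simp_rw [mul_add]

lemma digitMean_const_mul (u c : ℝ) (G : ℕ → ℝ) :
    digitMean u (fun k => c * G k) = c * digitMean u G := by
  unfold digitMean
  rw [← tsum_mul_left]
  simp_rw [mul_left_comm]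

lemma digitMean_neg (u : ℝ) (G : ℕ → ℝ) :
    digitMean u (fun k => -G k) = -digitMean u G := by
  simpa using digitMean_const_mul u (-1) G

lemma digitMean_sub (hu : 0 < u) (hF : AbsBounded F) (hG : AbsBounded G) :
    digitMean u (fun k => F k - G k) = digitMean u F - digitMean u G := by
  simpa only [sub_eq_add_neg, digitMean_neg] using digitMean_add hu hF hG.neg

lemma digitMean_mono (hu : 0 < u) (hF : AbsBounded F) (hG : AbsBounded G)
    (h : ∀ k, F k ≤ G k) : digitMean u F ≤ digitMean u G :=
  (summable_digitWeight_mul hu hF).tsum_le_tsum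
    (fun k => mul_le_mul_of_nonneg_left (h k) (digitWeight_nonneg hu k))
    (summable_digitWeight_mul hu hG)

lemma abs_digitMean_le (hu : 0 < u) {C : ℝ} (h : ∀ k, |G k| ≤ C) : |digitMean u G| ≤ C := by
  have hG : AbsBounded G := ⟨C, h⟩
  rw [abs_le]
  constructor
  · rw [← digitMean_const hu (-C)]
    exact digitMean_mono hu (.const _) hG fun k => (abs_le.1 (h k)).1
  · rw [← digitMean_const hu C]
    exact digitMean_mono hu hG (.const _) fun k => (abs_le.1 (h k)).2

lemma digitMean_eq_zero_add (hu : 0 < u) (hG : AbsBounded G) :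
    digitMean u G = 1 / (1 + u) * G 0 + u / (1 + u) * digitMean (1 + u) fun k => G (k + 1) := by
  unfold digitMean
  rw [(summable_digitWeight_mul hu hG).tsum_eq_zero_add, ← tsum_mul_left]
  congr 1
  · simp only [digitWeight, Nat.cast_zero, add_zero]
    field_simp
    ring_nf
  · refine tsum_congr fun k => ?_
    simp only [digitWeight]
    push_cast
    have : 0 < u + k + 1 := by positivity
    have : 0 < 1 + u + k := by positivity
    field_simp
    ring

lemma digitMean_indicator_ge (hu : 0 < u) (j : ℕ) :
    digitMean u (fun k => if j ≤ k then 1 else 0) = u / (u + j) := by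
  induction j generalizing u with
  | zero => simp [digitMean_const hu, hu.ne']
  | succ j ih =>
    rw [digitMean_eq_zero_add hu (absBounded_indicator _)]
    have h1 : (0 : ℝ) < 1 + u := by positivity
    simp only [Nat.add_le_add_iff_right, ih h1]
    push_cast
    simp
    field_simp
    ring

end digitMean

/-- The transfer operator of the Gauss map with respect to the Gauss measure. -/
noncomputable def gaussOp (f : ℝ → ℝ) (s : ℝ) : ℝ :=
  digitMean (1 + s) fun k => f (1 / (1 + s + k))

lemma one_div_mem_Icc {s : ℝ} (hs : 0 ≤ s) (k : ℕ) :
    1 / (1 + s + k) ∈ Set.Icc (0 : ℝ) 1 := by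
  have hk : (0 : ℝ) ≤ k := k.cast_nonneg
  refine ⟨by positivity, ?_⟩
  rw [div_le_one (by positivity)]
  linarith

lemma absBounded_comp_one_div {f : ℝ → ℝ} {C : ℝ} (hf : ∀ x ∈ Set.Icc (0 : ℝ) 1, |f x| ≤ C)
    {s : ℝ} (hs : 0 ≤ s) : AbsBounded fun k : ℕ => f (1 / (1 + s + k)) :=
  ⟨C, fun k => hf _ (one_div_mem_Icc hs k)⟩

lemma abs_gaussOp_le {f : ℝ → ℝ} {C : ℝ} (hf : ∀ x ∈ Set.Icc (0 : ℝ) 1, |f x| ≤ C)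
    {s : ℝ} (hs : 0 ≤ s) : |gaussOp f s| ≤ C :=
  abs_digitMean_le (by positivity) fun k => hf _ (one_div_mem_Icc hs k)

/-- `f` is Lipschitz on `[0, 1]` with constant `L`. -/
def UnitLipschitz (L : ℝ) (f : ℝ → ℝ) : Prop :=
  ∀ s ∈ Set.Icc (0 : ℝ) 1, ∀ t ∈ Set.Icc (0 : ℝ) 1, |f s - f t| ≤ L * |s - t|

lemma UnitLipschitz.abs_le {L : ℝ} {f : ℝ → ℝ} (hf : UnitLipschitz L f) (hL : 0 ≤ L) :
    ∀ x ∈ Set.Icc (0 : ℝ) 1, |f x| ≤ |f 0| + L := by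
  intro x hx
  have h := hf x hx 0 ⟨le_rfl, zero_le_one⟩
  have h1 : |x - 0| ≤ 1 := by rw [sub_zero, abs_of_nonneg hx.1]; exact hx.2
  have h2 : |f x| ≤ |f x - f 0| + |f 0| := by simpa using abs_add_le (f x - f 0) (f 0)
  nlinarith

lemma abs_one_div_sub_one_div {a b : ℝ} (ha : 0 < a) (hb : 0 < b) :
    |1 / a - 1 / b| = |a - b| / (a * b) := by
  have h : 1 / a - 1 / b = (b - a) / (a * b) := by field_simp
  rw [h, abs_div, abs_of_pos (mul_pos ha hb), abs_sub_comm]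

lemma abs_digitMean_sub_le {L : ℝ} {f : ℝ → ℝ} (hL : 0 ≤ L) (hf : UnitLipschitz L f)
    {s t : ℝ} (hs : s ∈ Set.Icc (0 : ℝ) 1) (ht : t ∈ Set.Icc (0 : ℝ) 1) :
    |digitMean (1 + s) (fun k => f (1 / (1 + s + k)) - f (1 / (1 + t + k)))|
      ≤ 5 / 8 * L * |s - t| := by
  have hs1 : 0 < 1 + s := by linarith [hs.1]
  have ht1 : 0 < 1 + t := by linarith [ht.1]
  set q : ℕ → ℝ := fun k => 1 - 3 / 4 * (if 1 ≤ k then 1 else 0) with hq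
  have hqb : AbsBounded q := (AbsBounded.const 1).sub
    ((AbsBounded.const _).mul (absBounded_indicator _))
  have hqm : digitMean (1 + s) q ≤ 5 / 8 := by
    rw [hq, digitMean_sub hs1 (.const 1)
      ((AbsBounded.const _).mul (absBounded_indicator _)), digitMean_const hs1,
      digitMean_const_mul, digitMean_indicator_ge hs1]
    have : (1 : ℝ) / 2 ≤ (1 + s) / (1 + s + (1 : ℕ)) := by
      rw [div_le_div_iff₀ (by norm_num) (by positivity)]
      push_cast
      linarith [hs.1]
    linarith
  have hle : ∀ k : ℕ, |f (1 / (1 + s + k)) - f (1 / (1 + t + k))| ≤ L * |s - t| * q k := by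
    intro k
    have hk : (0 : ℝ) ≤ k := k.cast_nonneg
    refine (hf _ (one_div_mem_Icc hs.1 k) _ (one_div_mem_Icc ht.1 k)).trans ?_
    rw [abs_one_div_sub_one_div (by positivity) (by positivity), mul_assoc]
    refine mul_le_mul_of_nonneg_left ?_ hL
    have e : 1 + s + (k : ℝ) - (1 + t + k) = s - t := by ring
    rw [e, div_le_iff₀ (by positivity), mul_assoc]
    refine le_mul_of_one_le_right (abs_nonneg _) ?_
    rcases Nat.eq_zero_or_pos k with rfl | hk'
    · simp only [hq, Nat.cast_zero]
      norm_num
      nlinarith [hs.1, ht.1]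
    · have : (1 : ℝ) ≤ k := by exact_mod_cast hk'
      have h1 : 1 ≤ k := hk'
      simp only [hq, h1, if_true]
      nlinarith [hs.1, ht.1]
  have hd : AbsBounded fun k : ℕ => f (1 / (1 + s + k)) - f (1 / (1 + t + k)) :=
    (absBounded_comp_one_div (hf.abs_le hL) hs.1).sub
      (absBounded_comp_one_div (hf.abs_le hL) ht.1)
  have hLq := (AbsBounded.const (L * |s - t|)).mul hqb
  have hLs : 0 ≤ L * |s - t| := by positivity
  have key : L * |s - t| * digitMean (1 + s) q ≤ 5 / 8 * L * |s - t| := by nlinarith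
  rw [abs_le]
  constructor
  · have := digitMean_mono hs1 hLq.neg hd fun k => (abs_le.1 (hle k)).1
    rw [digitMean_neg, digitMean_const_mul] at this
    linarith
  · have := digitMean_mono hs1 hd hLq fun k => (abs_le.1 (hle k)).2
    rw [digitMean_const_mul] at this
    linarith

lemma abs_digitMean_sub_digitMean_le {L : ℝ} {f : ℝ → ℝ} (hL : 0 ≤ L) (hf : UnitLipschitz L f)
    {s t : ℝ} (hs : s ∈ Set.Icc (0 : ℝ) 1) (ht : t ∈ Set.Icc (0 : ℝ) 1) :
    |digitMean (1 + s) (fun k => f (1 / (1 + t + k)))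
      - digitMean (1 + t) (fun k => f (1 / (1 + t + k)))| ≤ 1 / 4 * L * |s - t| := by
  have hs1 : 0 < 1 + s := by linarith [hs.1]
  have ht1 : 0 < 1 + t := by linarith [ht.1]
  set D : ℕ → ℝ := fun k => f (1 / (1 + t + k)) with hD
  have hDb : AbsBounded D := absBounded_comp_one_div (hf.abs_le hL) ht.1
  set d : ℕ → ℝ := fun k => (1 + s) / (1 + s + k) - (1 + t) / (1 + t + k) with hd
  have hd0 : d 0 = 0 := by simp [hd, hs1.ne', ht1.ne']
  have hstep : ∀ n : ℕ, |d (n + 1) * (D (n + 1) - D n)| ≤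
      L * |s - t| * (1 / 2 * (1 / ((n + 1) * (n + 2)) - 1 / ((n + 2) * (n + 3)))) := by
    intro n
    have hn : (0 : ℝ) ≤ n := n.cast_nonneg
    have h1 : |d (n + 1)| ≤ |s - t| * ((n + 1) / ((n + 2) * (n + 2))) := by
      have e : d (n + 1) = (s - t) * ((n + 1) / ((2 + s + n) * (2 + t + n))) := by
        have := hs.1
        have := ht.1
        simp only [hd]
        push_cast
        have e1 : 1 + s + ((n : ℝ) + 1) = 2 + s + n := by ring
        have e2 : 1 + t + ((n : ℝ) + 1) = 2 + t + n := by ring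
        rw [e1, e2]
        field_simp
        ring
      have := hs.1
      have := ht.1
      rw [e, abs_mul, abs_of_nonneg (show 0 ≤ ((n : ℝ) + 1) / ((2 + s + n) * (2 + t + n)) by
        positivity)]
      refine mul_le_mul_of_nonneg_left (div_le_div_of_nonneg_left (by positivity)
        (by positivity) (mul_le_mul ?_ ?_ (by positivity) (by positivity))) (abs_nonneg _) <;>
        linarith
    have h2 : |D (n + 1) - D n| ≤ L * (1 / ((n + 2) * (n + 1))) := by
      have := ht.1
      refine (hf _ (one_div_mem_Icc ht.1 _) _ (one_div_mem_Icc ht.1 _)).trans ?_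
      refine mul_le_mul_of_nonneg_left ?_ hL
      rw [abs_one_div_sub_one_div (by positivity) (by positivity)]
      have e : 1 + t + ((n + 1 : ℕ) : ℝ) - (1 + t + n) = 1 := by push_cast; ring
      rw [e, abs_one]
      push_cast
      refine div_le_div_of_nonneg_left zero_le_one (by positivity)
        (mul_le_mul ?_ ?_ (by positivity) (by positivity)) <;> linarith
    rw [abs_mul]
    refine (mul_le_mul h1 h2 (abs_nonneg _) (by positivity)).trans ?_
    have e : |s - t| * (((n : ℝ) + 1) / ((n + 2) * (n + 2))) * (L * (1 / ((n + 2) * (n + 1))))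
        = L * |s - t| * (1 / ((n + 2) * (n + 2) * (n + 2))) := by field_simp
    rw [e]
    refine mul_le_mul_of_nonneg_left ?_ (by positivity)
    have e2 : (1 : ℝ) / 2 * (1 / ((n + 1) * (n + 2)) - 1 / ((n + 2) * (n + 3)))
        = 1 / ((n + 1) * (n + 2) * (n + 3)) := by field_simp; ring
    rw [e2]
    exact one_div_le_one_div_of_le (by positivity) (by nlinarith)
  have hsum : ∀ n : ℕ, |∑ k ∈ Finset.range n, (d k - d (k + 1)) * D k + d n * D n| ≤
      L * |s - t| * (1 / 2 * (1 / 2 - 1 / ((n + 1) * (n + 2)))) := by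
    intro n
    induction n with
    | zero => simp [hd0]
    | succ n ih =>
      have e : ∑ k ∈ Finset.range (n + 1), (d k - d (k + 1)) * D k + d (n + 1) * D (n + 1)
          = (∑ k ∈ Finset.range n, (d k - d (k + 1)) * D k + d n * D n)
            + d (n + 1) * (D (n + 1) - D n) := by
        rw [Finset.sum_range_succ]; ring
      rw [e]
      refine (abs_add_le _ _).trans ((add_le_add ih (hstep n)).trans (le_of_eq ?_))
      push_cast
      ring
  have hwt : ∀ k, d k - d (k + 1) = digitWeight (1 + s) k - digitWeight (1 + t) k := by
    intro k
    rw [digitWeight_eq_sub hs1, digitWeight_eq_sub ht1]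
    simp only [hd]
    ring
  have hlim1 : Tendsto (fun n => ∑ k ∈ Finset.range n, (d k - d (k + 1)) * D k) atTop
      (nhds (digitMean (1 + s) D - digitMean (1 + t) D)) := by
    simp_rw [hwt, sub_mul]
    exact ((summable_digitWeight_mul hs1 hDb).hasSum.sub
      (summable_digitWeight_mul ht1 hDb).hasSum).tendsto_sum_nat
  have hlim2 : Tendsto (fun n => d n * D n) atTop (nhds 0) := by
    have hd' : Tendsto d atTop (nhds 0) := by
      simpa using (tendsto_div_add_natCast (1 + s)).sub (tendsto_div_add_natCast (1 + t))
    obtain ⟨C, hC⟩ := hDb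
    refine squeeze_zero_norm (a := fun n => |d n| * C) (fun n => ?_) ?_
    · rw [norm_mul, Real.norm_eq_abs, Real.norm_eq_abs]
      exact mul_le_mul_of_nonneg_left (hC n) (abs_nonneg _)
    · simpa using hd'.abs.mul_const C
  have hlim := (hlim1.add hlim2).abs
  rw [add_zero] at hlim
  refine le_of_tendsto hlim (Eventually.of_forall fun n => (hsum n).trans ?_)
  have h1 : (0 : ℝ) ≤ 1 / ((n + 1) * (n + 2)) := by positivity
  have h2 : 0 ≤ L * |s - t| := by positivity
  nlinarith [mul_nonneg h2 h1]

lemma UnitLipschitz.gaussOp {L : ℝ} {f : ℝ → ℝ} (hL : 0 ≤ L) (hf : UnitLipschitz L f) :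
    UnitLipschitz (7 / 8 * L) (gaussOp f) := by
  intro s hs t ht
  have h1 := abs_digitMean_sub_le hL hf hs ht
  have h2 := abs_digitMean_sub_digitMean_le hL hf hs ht
  rw [digitMean_sub (by linarith [hs.1]) (absBounded_comp_one_div (hf.abs_le hL) hs.1)
    (absBounded_comp_one_div (hf.abs_le hL) ht.1)] at h1
  have e : _root_.gaussOp f s - _root_.gaussOp f t =
    (digitMean (1 + s) (fun k => f (1 / (1 + s + k)))
      - digitMean (1 + s) (fun k => f (1 / (1 + t + k))))
    + (digitMean (1 + s) (fun k => f (1 / (1 + t + k)))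
      - digitMean (1 + t) (fun k => f (1 / (1 + t + k)))) := by
    simp only [_root_.gaussOp]; ring
  rw [e]
  refine (abs_add_le _ _).trans ((add_le_add h1 h2).trans (le_of_eq ?_))
  ring

lemma unitLipschitz_iterate_gaussOp (j : ℕ) : UnitLipschitz ((7 / 8) ^ j) (gaussOp^[j] id) := by
  induction j with
  | zero => intro s _ t _; simp
  | succ j ih =>
    rw [Function.iterate_succ_apply', pow_succ']
    exact ih.gaussOp (by positivity)

lemma abs_iterate_gaussOp_le (j : ℕ) : ∀ x ∈ Set.Icc (0 : ℝ) 1, |gaussOp^[j] id x| ≤ 1 := by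
  induction j with
  | zero => intro x hx; simpa [abs_of_nonneg hx.1] using hx.2
  | succ j ih =>
    intro x hx
    rw [Function.iterate_succ_apply']
    exact abs_gaussOp_le ih hx.1

/-- Partial sums of the alternating series for `(1 + gaussOp)⁻¹ id`. -/
noncomputable def altSum (g : ℕ → ℝ → ℝ) (m : ℕ) (s : ℝ) : ℝ :=
  ∑ j ∈ Finset.range m, (-1) ^ j * g j s

lemma abs_altSum_le {g : ℕ → ℝ → ℝ} (hg : ∀ j, ∀ x ∈ Set.Icc (0 : ℝ) 1, |g j x| ≤ 1) (m : ℕ) :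
    ∀ x ∈ Set.Icc (0 : ℝ) 1, |altSum g m x| ≤ m := by
  intro x hx
  refine (Finset.abs_sum_le_sum_abs _ _).trans ?_
  refine (Finset.sum_le_sum (g := fun _ => (1 : ℝ)) fun j _ => ?_).trans (by simp)
  rw [abs_mul, abs_pow, abs_neg, abs_one, one_pow, one_mul]
  exact hg j x hx

lemma gaussOp_altSum {g : ℕ → ℝ → ℝ} (hg : ∀ j, ∀ x ∈ Set.Icc (0 : ℝ) 1, |g j x| ≤ 1) (m : ℕ)
    {s : ℝ} (hs : 0 ≤ s) :
    gaussOp (altSum g m) s = altSum (fun j => gaussOp (g j)) m s := by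
  induction m with
  | zero => simp [gaussOp, altSum, digitMean]
  | succ m ih =>
    have hs1 : 0 < 1 + s := by positivity
    have e : gaussOp (altSum g (m + 1)) s =
        gaussOp (altSum g m) s + (-1) ^ m * gaussOp (g m) s := by
      simp only [gaussOp]
      rw [← digitMean_const_mul, ← digitMean_add hs1
        (absBounded_comp_one_div (abs_altSum_le hg m) hs)
        ((AbsBounded.const _).mul (absBounded_comp_one_div (hg m) hs))]
      simp only [altSum, Finset.sum_range_succ]
    rw [e, ih]
    simp only [altSum, Finset.sum_range_succ]

lemma gaussOp_congr {f g : ℝ → ℝ} (h : ∀ x ∈ Set.Icc (0 : ℝ) 1, f x = g x) {s : ℝ}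
    (hs : 0 ≤ s) : gaussOp f s = gaussOp g s := by
  unfold gaussOp
  congr 1
  funext k
  exact h _ (one_div_mem_Icc hs k)

lemma exists_gauss_corrector {ε : ℝ} (hε : 0 < ε) :
    ∃ (ψ : ℝ → ℝ) (C : ℝ), (∀ x ∈ Set.Icc (0 : ℝ) 1, |ψ x| ≤ C) ∧
      ∀ s ∈ Set.Icc (0 : ℝ) 1,
        |gaussOp (gaussOp ψ) s - ψ s - (gaussOp id s - s)| ≤ ε := by
  obtain ⟨m, hm⟩ := exists_pow_lt_of_lt_one hε (show (7 / 8 : ℝ) < 1 by norm_num)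
  set g : ℕ → ℝ → ℝ := fun j => gaussOp^[j] id with hg
  have hsucc : ∀ j, gaussOp (g j) = g (j + 1) := fun j => by
    simp only [hg, Function.iterate_succ_apply']
  refine ⟨altSum g m, m, abs_altSum_le abs_iterate_gaussOp_le m, fun s hs => ?_⟩
  have hg1 : ∀ j, ∀ x ∈ Set.Icc (0 : ℝ) 1, |g j x| ≤ 1 := abs_iterate_gaussOp_le
  have h1 : gaussOp (gaussOp (altSum g m)) s = altSum (fun j => g (j + 2)) m s := by
    have e : ∀ x ∈ Set.Icc (0 : ℝ) 1,
        gaussOp (altSum g m) x = altSum (fun j => g (j + 1)) m x := fun x hx => by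
      rw [gaussOp_altSum hg1 m hx.1]
      simp only [hsucc]
    rw [gaussOp_congr e hs.1, gaussOp_altSum (fun j => hg1 (j + 1)) m hs.1]
    simp only [hsucc]
  have h2 : ∀ n, altSum (fun j => g (j + 2)) n s - altSum g n s - (g 1 s - g 0 s)
      = (-1) ^ n * (g n s - g (n + 1) s) := by
    intro n
    induction n with
    | zero => simp [altSum]
    | succ n ih =>
      simp only [altSum, Finset.sum_range_succ] at ih ⊢
      rw [pow_succ]
      linear_combination ih
  have h3 := h2 m
  simp only [hg, Function.iterate_one, Function.iterate_zero, id_eq] at h3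
  rw [h1, h3, abs_mul, abs_pow, abs_neg, abs_one, one_pow, one_mul]
  refine le_trans ?_ hm.le
  have hs1 : 0 < 1 + s := by linarith [hs.1]
  rw [Function.iterate_succ_apply', gaussOp,
    ← digitMean_const hs1 (gaussOp^[m] id s), ← digitMean_sub hs1 (.const _)
    (absBounded_comp_one_div (abs_iterate_gaussOp_le m) hs.1)]
  refine abs_digitMean_le hs1 fun k => ?_
  have hk := one_div_mem_Icc hs.1 k
  refine (unitLipschitz_iterate_gaussOp m _ hs _ hk).trans ?_
  refine mul_le_of_le_one_right (by positivity) ?_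
  rw [abs_le]
  constructor <;> linarith [hs.1, hs.2, hk.1, hk.2]

/-- The state following the state `u` after the digit `k + 2`. -/
noncomputable def nextState (u : ℝ) (k : ℕ) : ℝ := (u + k) / (u + k + 1)

lemma nextState_mem {u : ℝ} (hu : 0 < u) (k : ℕ) : nextState u k ∈ Set.Ioc (0 : ℝ) 1 := by
  unfold nextState
  refine ⟨by positivity, ?_⟩
  rw [div_le_one (by positivity)]
  linarith

lemma one_div_nextState {u : ℝ} (hu : 0 < u) (k : ℕ) : 1 / nextState u k = 1 + 1 / (u + k) := by
  unfold nextState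
  field_simp

lemma one_div_nextState_zero {u : ℝ} (hu : 0 < u) : 1 / nextState u 0 = 1 + 1 / u := by
  simpa using one_div_nextState hu 0

lemma one_div_nextState_succ {u : ℝ} (hu : 0 < u) (k : ℕ) :
    1 / nextState u (k + 1) = 1 + 1 / (1 + u + k) := by
  rw [one_div_nextState hu]
  push_cast
  ring_nf

lemma one_div_nextState_le {u : ℝ} (hu : 0 < u) (k : ℕ) : 1 / nextState u k ≤ 1 + 1 / u := by
  rw [one_div_nextState hu]
  gcongr
  have : (0 : ℝ) ≤ k := k.cast_nonneg
  linarith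

lemma absBounded_comp_nextState {h : ℝ → ℝ} {C : ℝ} (hC : ∀ x ∈ Set.Ioc (0 : ℝ) 1, |h x| ≤ C)
    {u : ℝ} (hu : 0 < u) : AbsBounded fun k => h (nextState u k) :=
  ⟨C, fun k => hC _ (nextState_mem hu k)⟩

lemma absBounded_one_div_nextState {u : ℝ} (hu : 0 < u) :
    AbsBounded fun k => 1 / nextState u k := by
  refine ⟨1 + 1 / u, fun k => ?_⟩
  rw [abs_of_pos (one_div_pos.2 (nextState_mem hu k).1)]
  exact one_div_nextState_le hu k

lemma absBounded_one_div {s : ℝ} (hs : 0 ≤ s) : AbsBounded fun k : ℕ => 1 / (1 + s + k) :=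
  absBounded_comp_one_div (f := id) (C := 1)
    (fun x hx => by simpa [abs_of_nonneg hx.1] using hx.2) hs

lemma gaussOp_id_mem {s : ℝ} (hs : 0 ≤ s) : gaussOp id s ∈ Set.Icc (0 : ℝ) 1 := by
  have hb := absBounded_one_div hs
  have hs1 : 0 < 1 + s := by positivity
  refine ⟨?_, ?_⟩
  · rw [← digitMean_const hs1 0]
    exact digitMean_mono hs1 (.const 0) hb fun k => (one_div_mem_Icc hs k).1
  · rw [← digitMean_const hs1 1]
    exact digitMean_mono hs1 hb (.const 1) fun k => (one_div_mem_Icc hs k).2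

lemma digitMean_one_div_nextState {u : ℝ} (hu : 0 < u) :
    digitMean u (fun k => 1 / nextState u k) = 1 / u + u / (1 + u) * (1 + gaussOp id u) := by
  have hu1 : 0 < 1 + u := by positivity
  rw [digitMean_eq_zero_add hu (absBounded_one_div_nextState hu), one_div_nextState_zero hu]
  simp only [one_div_nextState_succ hu]
  rw [digitMean_add hu1 (.const 1) (absBounded_one_div hu.le), digitMean_const hu1]
  simp only [gaussOp, id]
  field_simp
  ring

lemma digitMean_one_div_nextState_le {u : ℝ} (hu : 0 < u) :
    digitMean u (fun k => 1 / nextState u k) ≤ 1 / u + 2 * u := by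
  rw [digitMean_one_div_nextState hu]
  have h := (gaussOp_id_mem hu.le).2
  have h2 : u / (1 + u) ≤ u := div_le_self hu.le (by linarith)
  have h3 : 0 ≤ u / (1 + u) := by positivity
  nlinarith

lemma exists_state_corrector {ε : ℝ} (hε : 0 < ε) :
    ∃ (h : ℝ → ℝ) (C : ℝ), (∀ u ∈ Set.Ioc (0 : ℝ) 1, |h u| ≤ C) ∧ ∀ u ∈ Set.Ioc (0 : ℝ) 1,
      |digitMean u (fun k => h (nextState u k)) - h u - u / (1 + u) * (gaussOp id u - u)|
        ≤ ε * u := by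
  obtain ⟨ψ, C, hψ, hψ'⟩ := exists_gauss_corrector hε
  set h : ℝ → ℝ := fun u => digitMean (1 / u) fun k => ψ (1 / (1 / u + k)) with hh
  have hb : ∀ r : ℝ, 1 ≤ r → ∀ k : ℕ, |ψ (1 / (r + k))| ≤ C := fun r hr k => by
    refine hψ _ ⟨by positivity, ?_⟩
    have : (0 : ℝ) ≤ k := k.cast_nonneg
    rw [div_le_one (by positivity)]
    linarith
  have hhC : ∀ u ∈ Set.Ioc (0 : ℝ) 1, |h u| ≤ C := fun u hu =>
    abs_digitMean_le (one_div_pos.2 hu.1) (hb _ (one_le_one_div hu.1 hu.2))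
  refine ⟨h, C, hhC, fun u hu => ?_⟩
  have hu0 := hu.1
  have hs : u ∈ Set.Icc (0 : ℝ) 1 := ⟨hu.1.le, hu.2⟩
  have h0 : h u = 1 / (1 + 1 / u) * ψ u + 1 / u / (1 + 1 / u) * h (nextState u 0) := by
    simp only [hh]
    rw [one_div_nextState_zero hu0, digitMean_eq_zero_add (one_div_pos.2 hu0)
      ⟨C, hb _ (one_le_one_div hu.1 hu.2)⟩]
    push_cast
    congr 2
    · simp
    · simp only [add_assoc, add_comm]
  have h1 : ∀ k, h (nextState u (k + 1)) = gaussOp ψ (1 / (1 + u + k)) := fun k => by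
    simp only [hh, gaussOp, one_div_nextState_succ hu0]
  rw [digitMean_eq_zero_add hu0 (absBounded_comp_nextState hhC hu0)]
  simp only [h1]
  have h2 : digitMean (1 + u) (fun k => gaussOp ψ (1 / (1 + u + k))) = gaussOp (gaussOp ψ) u := rfl
  rw [h2]
  have e : 1 / (1 + u) * h (nextState u 0) + u / (1 + u) * gaussOp (gaussOp ψ) u - h u
      - u / (1 + u) * (gaussOp id u - u)
      = u / (1 + u) * (gaussOp (gaussOp ψ) u - ψ u - (gaussOp id u - u)) := by
    rw [h0]
    field_simp
    ring
  rw [e, abs_mul, abs_of_nonneg (by positivity), mul_comm]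
  exact mul_le_mul (hψ' u hs) (div_le_self hu0.le (by linarith)) (by positivity) hε.le

/-- The potential `r (log r - L)` with `r = 1 / u`. -/
noncomputable def logPot (L u : ℝ) : ℝ := 1 / u * (log (1 / u) - L)

lemma logPot_le_of_le {L u R : ℝ} (hL : 0 ≤ L) (hu : u ∈ Set.Ioc (0 : ℝ) 1) (hR : 1 / u ≤ R) :
    |logPot L u| ≤ R * (log R + L) := by
  have h1 := one_le_one_div hu.1 hu.2
  have h2 : 0 ≤ log (1 / u) := log_nonneg h1
  have h3 : log (1 / u) ≤ log R := log_le_log (by linarith) hR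
  rw [logPot, abs_mul, abs_of_pos (one_div_pos.2 hu.1)]
  refine mul_le_mul hR ?_ (abs_nonneg _) (by linarith)
  rw [abs_le]
  constructor <;> linarith

lemma absBounded_logPot {L u : ℝ} (hL : 0 ≤ L) (hu : 0 < u) :
    AbsBounded fun k => logPot L (nextState u k) :=
  ⟨_, fun k => logPot_le_of_le hL (nextState_mem hu k) (one_div_nextState_le hu k)⟩

lemma neg_logPot_le_exp (L : ℝ) {u : ℝ} (hu : 0 < u) : -logPot L u ≤ exp L := by
  have h := log_le_sub_one_of_pos (show 0 < u * exp L by positivity)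
  rw [log_mul hu.ne' (exp_pos L).ne', log_exp] at h
  have e : -logPot L u = 1 / u * (log u + L) := by
    rw [logPot, one_div, log_inv]; ring
  rw [e, one_div, ← div_eq_inv_mul, div_le_iff₀ hu]
  linarith

/-- The mean of `ρ log ρ`, where `ρ` is the reciprocal state right after a digit at least `3`. -/
noncomputable def entropyMean (u : ℝ) : ℝ :=
  digitMean (1 + u) fun k => (1 + 1 / (1 + u + k)) * log (1 + 1 / (1 + u + k))

lemma mul_log_mem {ρ : ℝ} (h1 : 1 ≤ ρ) (h2 : ρ ≤ 2) : ρ * log ρ ∈ Set.Icc (0 : ℝ) 2 := by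
  have h3 := log_nonneg h1
  have h4 := log_le_sub_one_of_pos (show 0 < ρ by linarith)
  exact ⟨by positivity, by nlinarith⟩

lemma one_add_one_div_mem {u : ℝ} (hu : 0 < u) (k : ℕ) :
    1 + 1 / (1 + u + k) ∈ Set.Icc (1 : ℝ) 2 := by
  have := one_div_mem_Icc hu.le k
  exact ⟨by linarith [this.1], by linarith [this.2]⟩

lemma absBounded_entropy {u : ℝ} (hu : 0 < u) :
    AbsBounded fun k : ℕ => (1 + 1 / (1 + u + k)) * log (1 + 1 / (1 + u + k)) := by
  refine ⟨2, fun k => ?_⟩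
  have h := one_add_one_div_mem hu k
  have := mul_log_mem h.1 h.2
  rw [abs_of_nonneg this.1]
  exact this.2

lemma entropyMean_mem {u : ℝ} (hu : 0 < u) : entropyMean u ∈ Set.Icc (0 : ℝ) 2 := by
  have hu1 : 0 < 1 + u := by positivity
  have hm := fun k : ℕ => mul_log_mem (one_add_one_div_mem hu k).1 (one_add_one_div_mem hu k).2
  constructor
  · rw [← digitMean_const hu1 0]
    exact digitMean_mono hu1 (.const 0) (absBounded_entropy hu) fun k => (hm k).1
  · rw [← digitMean_const hu1 2]
    exact digitMean_mono hu1 (absBounded_entropy hu) (.const 2) fun k => (hm k).2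

lemma logPot_nextState_zero (L : ℝ) {u : ℝ} (hu : 0 < u) :
    logPot L (nextState u 0) = (1 + 1 / u) * (log (1 + u) + log (1 / u) - L) := by
  have e : 1 + 1 / u = (1 + u) * (1 / u) := by field_simp; ring
  rw [logPot, one_div_nextState_zero hu]
  congr 2
  rw [e, log_mul (by positivity) (by positivity)]

lemma logPot_nextState_succ (L : ℝ) {u : ℝ} (hu : 0 < u) (k : ℕ) :
    logPot L (nextState u (k + 1)) =
      (1 + 1 / (1 + u + k)) * log (1 + 1 / (1 + u + k)) - L * (1 + 1 / (1 + u + k)) := by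
  rw [logPot, one_div_nextState_succ hu]
  ring

lemma digitMean_logPot {L u : ℝ} (hL : 0 ≤ L) (hu : 0 < u) :
    digitMean u (fun k => logPot L (nextState u k)) =
      logPot L u + 1 / u * log (1 + u)
        + u / (1 + u) * (entropyMean u - L * (1 + gaussOp id u)) := by
  have hu1 : 0 < 1 + u := by positivity
  have hid := absBounded_one_div hu.le
  rw [digitMean_eq_zero_add hu (absBounded_logPot hL hu), logPot_nextState_zero L hu]
  simp only [logPot_nextState_succ L hu]
  rw [digitMean_sub hu1 (absBounded_entropy hu)
    ((AbsBounded.const L).mul ((AbsBounded.const 1).add hid)), digitMean_const_mul,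
    digitMean_add hu1 (.const 1) hid, digitMean_const hu1]
  have e1 : digitMean (1 + u) (fun k => 1 / (1 + u + k)) = gaussOp id u := rfl
  rw [e1, ← entropyMean, logPot]
  field_simp
  ring

lemma one_div_mul_log_mem {u : ℝ} (hu : u ∈ Set.Ioc (0 : ℝ) 1) :
    1 / u * log (1 + u) ∈ Set.Icc (1 - u) 1 := by
  have hu0 := hu.1
  have h1 := log_le_sub_one_of_pos (show 0 < 1 + u by linarith)
  have h2 := one_sub_inv_le_log_of_pos (show 0 < 1 + u by linarith)
  rw [one_div, ← div_eq_inv_mul]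
  constructor
  · rw [le_div_iff₀ hu0]
    refine le_trans ?_ h2
    have : 1 - (1 + u)⁻¹ = u / (1 + u) := by field_simp; ring
    rw [this, le_div_iff₀ (by linarith)]
    nlinarith [mul_pos hu0 (mul_pos hu0 hu0)]
  · rw [div_le_one hu0]
    linarith

lemma digitMean_logPot_le {L u : ℝ} (hL : 0 ≤ L) (hu : u ∈ Set.Ioc (0 : ℝ) 1) :
    digitMean u (fun k => logPot L (nextState u k)) ≤ logPot L u + 1 - (L / 2 - 2) * u := by
  have hu0 := hu.1
  have h1 := (one_div_mul_log_mem hu).2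
  have h2 := (entropyMean_mem hu0).2
  have h3 := (gaussOp_id_mem hu0.le).1
  rw [digitMean_logPot hL hu0]
  have h4 : u / (1 + u) * (entropyMean u - L * (1 + gaussOp id u)) ≤ u / (1 + u) * (2 - L) := by
    refine mul_le_mul_of_nonneg_left ?_ (by positivity)
    nlinarith
  have h5 : u / (1 + u) ≤ u := div_le_self hu0.le (by linarith)
  have h6 : u / 2 ≤ u / (1 + u) := div_le_div_of_nonneg_left hu0.le (by linarith) (by linarith [hu.2])
  nlinarith

/-- The digit excess `k` truncated at `M`. -/
noncomputable def truncDigit (M k : ℕ) : ℝ := min k M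

lemma absBounded_truncDigit (M : ℕ) : AbsBounded (truncDigit M) := by
  refine ⟨M, fun k => ?_⟩
  have : (0 : ℝ) ≤ truncDigit M k := le_min k.cast_nonneg M.cast_nonneg
  rw [abs_of_nonneg this]
  exact min_le_right _ _

lemma truncDigit_succ (M k : ℕ) :
    truncDigit (M + 1) k = truncDigit M k + if M + 1 ≤ k then 1 else 0 := by
  unfold truncDigit
  split_ifs with h
  · have : (M : ℝ) + 1 ≤ k := by exact_mod_cast h
    rw [min_eq_right (by push_cast; exact this), min_eq_right (by linarith)]
    push_cast; ring
  · have : (k : ℝ) ≤ M := by exact_mod_cast Nat.lt_succ_iff.1 (not_le.1 h)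
    rw [min_eq_left (by push_cast; linarith), min_eq_left this, add_zero]

lemma digitMean_truncDigit {u : ℝ} (hu : 0 < u) (M : ℕ) :
    digitMean u (truncDigit M) = ∑ j ∈ Finset.range M, u / (u + (j + 1)) := by
  induction M with
  | zero =>
    have : truncDigit 0 = fun _ => 0 := by
      funext k; simp [truncDigit]
    rw [this, digitMean_const hu]
    simp
  | succ M ih =>
    rw [funext (truncDigit_succ M), digitMean_add hu (absBounded_truncDigit M)
      (absBounded_indicator _), ih, digitMean_indicator_ge hu, Finset.sum_range_succ]
    push_cast
    rfl

lemma abs_digitMean_truncDigit_sub_le {u : ℝ} (hu : u ∈ Set.Ioc (0 : ℝ) 1) {M : ℕ} (hM : 1 ≤ M) :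
    |digitMean u (truncDigit M) - u * log M| ≤ u := by
  have hu0 := hu.1
  have hsum : ∀ n : ℕ, ((harmonic n : ℚ) : ℝ) = ∑ j ∈ Finset.range n, ((j : ℝ) + 1)⁻¹ := by
    intro n; simp [harmonic]
  have hup : digitMean u (truncDigit M) ≤ u * harmonic M := by
    rw [digitMean_truncDigit hu0, hsum, Finset.mul_sum]
    refine Finset.sum_le_sum fun j _ => ?_
    rw [← div_eq_mul_inv]
    exact div_le_div_of_nonneg_left hu0.le (by positivity) (by linarith)
  have hlo : u * (harmonic (M + 1) - 1) ≤ digitMean u (truncDigit M) := by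
    rw [digitMean_truncDigit hu0, hsum, Finset.sum_range_succ']
    simp only [Nat.cast_zero, zero_add, inv_one, add_sub_cancel_right]
    rw [Finset.mul_sum]
    refine Finset.sum_le_sum fun j _ => ?_
    rw [← div_eq_mul_inv]
    push_cast
    exact div_le_div_of_nonneg_left hu0.le (by positivity) (by linarith [hu.2])
  have h1 := harmonic_le_one_add_log M
  have h2 := log_add_one_le_harmonic (M + 1)
  have hM0 : (0 : ℝ) < M := by exact_mod_cast hM
  have h3 : log M ≤ log ((M + 1 : ℕ) + 1 : ℝ) := log_le_log hM0 (by push_cast; linarith)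
  have h4 : log (M : ℝ) ≤ harmonic (M + 1) := by
    refine h3.trans ?_
    simpa using h2
  rw [abs_le]
  constructor <;> nlinarith

lemma digitMean_truncDigit_sq_le {u : ℝ} (hu : 0 < u) (M : ℕ) :
    digitMean u (fun k => truncDigit M k ^ 2) ≤ 2 * M * u := by
  induction M with
  | zero =>
    have : (fun k => truncDigit 0 k ^ 2) = fun _ => 0 := by
      funext k; simp [truncDigit]
    rw [this, digitMean_const hu]
    simp
  | succ M ih =>
    have e : ∀ k, truncDigit (M + 1) k ^ 2 =
        truncDigit M k ^ 2 + (2 * M + 1) * if M + 1 ≤ k then 1 else 0 := by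
      intro k
      rw [truncDigit_succ]
      split_ifs with h
      · have : truncDigit M k = M :=
          min_eq_right (by exact_mod_cast (Nat.le_succ M).trans h)
        rw [this]; ring
      · ring
    simp only [e]
    rw [digitMean_add hu ((absBounded_truncDigit M).pow 2)
      ((AbsBounded.const _).mul (absBounded_indicator _)), digitMean_const_mul,
      digitMean_indicator_ge hu]
    have h2 : (2 * (M : ℝ) + 1) * (u / (u + (M + 1 : ℕ))) ≤ 2 * u := by
      rw [← mul_div_assoc, div_le_iff₀ (by positivity)]
      push_cast
      nlinarith
    push_cast
    push_cast at h2
    linarith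

/-- The excess over `2` of the first negative continued fraction digit of `1 - y`. -/
noncomputable def digitExcess (y : ℝ) : ℕ := ⌈1 / y⌉.toNat - 2

/-- The conditional density of the orbit point in state `u`. -/
noncomputable def stateDensity (u y : ℝ) : ℝ := u / (1 - (1 - u) * y) ^ 2

lemma one_sub_mul_pos {u y : ℝ} (hu : u ∈ Set.Ioc (0 : ℝ) 1) (hy : y ∈ Set.Ico (0 : ℝ) 1) :
    0 < 1 - (1 - u) * y := by
  nlinarith [hu.1, hu.2, hy.1, hy.2]

/-- The inverse branches of `negT`. -/
noncomputable def negBranch (k : ℕ) (t : ℝ) : ℝ := 1 / (k + 2 - t)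

lemma negBranch_mem (k : ℕ) {t : ℝ} (ht : t ∈ Set.Ico (0 : ℝ) 1) :
    negBranch k t ∈ Set.Ioo (0 : ℝ) 1 := by
  have hk : (0 : ℝ) ≤ k := k.cast_nonneg
  have : 1 < (k : ℝ) + 2 - t := by linarith [ht.2]
  unfold negBranch
  exact ⟨by positivity, by rw [div_lt_one (by linarith)]; exact this⟩

lemma digitExcess_negBranch (k : ℕ) {t : ℝ} (ht : t ∈ Set.Ico (0 : ℝ) 1) :
    digitExcess (negBranch k t) = k := by
  have h : ⌈1 / negBranch k t⌉ = (k : ℤ) + 2 := by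
    rw [negBranch, one_div_one_div, Int.ceil_eq_iff]
    push_cast
    exact ⟨by linarith [ht.2], by linarith [ht.1]⟩
  rw [digitExcess, h]
  omega

lemma negT_negBranch (k : ℕ) {t : ℝ} (ht : t ∈ Set.Ico (0 : ℝ) 1) :
    negT (negBranch k t) = t := by
  have h : -1 / negBranch k t = t + ((-(k + 2) : ℤ) : ℝ) := by
    rw [negBranch, neg_div, one_div_one_div]
    push_cast
    ring
  rw [negT, h, Int.fract_add_intCast, Int.fract_eq_self.2 ht]

lemma negT_mem (y : ℝ) : negT y ∈ Set.Ico (0 : ℝ) 1 := ⟨Int.fract_nonneg _, Int.fract_lt_one _⟩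

lemma negT_eq (y : ℝ) : negT y = ⌈1 / y⌉ - 1 / y := by
  rw [negT, neg_div, Int.fract, Int.floor_neg]
  push_cast
  ring

lemma ceil_eq_digitExcess {y : ℝ} (hy : y ∈ Set.Ioo (0 : ℝ) 1) :
    ⌈1 / y⌉ = digitExcess y + 2 := by
  have h1 : 1 < 1 / y := by rw [lt_div_iff₀ hy.1]; linarith [hy.2]
  have h2 : (1 : ℤ) < ⌈1 / y⌉ := by
    rw [Int.lt_ceil]; exact_mod_cast h1
  rw [digitExcess]
  omega

lemma negBranch_negT {y : ℝ} (hy : y ∈ Set.Ioo (0 : ℝ) 1) :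
    negBranch (digitExcess y) (negT y) = y := by
  rw [negBranch, negT_eq, ceil_eq_digitExcess hy]
  push_cast
  have : (digitExcess y : ℝ) + 2 - (digitExcess y + 2 - 1 / y) = 1 / y := by ring
  rw [this, one_div_one_div]

lemma iUnion_negBranch_image : ⋃ k, negBranch k '' Set.Ico 0 1 = Set.Ioo (0 : ℝ) 1 := by
  ext y
  simp only [Set.mem_iUnion]
  constructor
  · rintro ⟨k, t, ht, rfl⟩
    exact negBranch_mem k ht
  · intro hy
    exact ⟨digitExcess y, negT y, negT_mem y, negBranch_negT hy⟩

lemma hasDerivAt_negBranch (k : ℕ) {t : ℝ} (ht : t ∈ Set.Ico (0 : ℝ) 1) :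
    HasDerivAt (negBranch k) (1 / (k + 2 - t) ^ 2) t := by
  have hk : (0 : ℝ) ≤ k := k.cast_nonneg
  have h0 : (k : ℝ) + 2 - t ≠ 0 := by linarith [ht.2]
  have h := ((hasDerivAt_id t).const_sub ((k : ℝ) + 2)).inv h0
  simp only [id, neg_neg] at h
  have e : negBranch k = (fun x : ℝ => (k : ℝ) + 2 - x)⁻¹ := by
    funext x
    simp [negBranch]
  rw [e]
  exact h

lemma injOn_negBranch (k : ℕ) : Set.InjOn (negBranch k) (Set.Ico 0 1) := fun s hs t ht h => by
  rw [← negT_negBranch k hs, h, negT_negBranch k ht]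

lemma measurable_negT : Measurable negT := by
  unfold negT
  fun_prop

lemma measurable_digitExcess : Measurable digitExcess := by
  have h : Measurable fun y : ℝ => ⌈1 / y⌉ := Int.measurable_ceil.comp (by fun_prop)
  exact (measurable_from_top (f := fun z : ℤ => z.toNat - 2)).comp h

lemma measurableSet_negBranch_image (k : ℕ) : MeasurableSet (negBranch k '' Set.Ico 0 1) := by
  have e : negBranch k '' Set.Ico 0 1 = Set.Ioo 0 1 ∩ digitExcess ⁻¹' {k} := by
    ext y
    constructor
    · rintro ⟨t, ht, rfl⟩
      exact ⟨negBranch_mem k ht, digitExcess_negBranch k ht⟩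
    · rintro ⟨hy, rfl⟩
      exact ⟨negT y, negT_mem y, negBranch_negT hy⟩
  rw [e]
  exact measurableSet_Ioo.inter (measurable_digitExcess (measurableSet_singleton k))

lemma stateDensity_negBranch {u : ℝ} (hu : u ∈ Set.Ioc (0 : ℝ) 1) (k : ℕ) {t : ℝ}
    (ht : t ∈ Set.Ico (0 : ℝ) 1) :
    1 / (k + 2 - t) ^ 2 * stateDensity u (negBranch k t) =
      digitWeight u k * stateDensity (nextState u k) t := by
  have hk : (0 : ℝ) ≤ k := k.cast_nonneg
  have hu0 := hu.1
  have h1 : 0 < (k : ℝ) + 2 - t := by linarith [ht.2]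
  have h2 : 0 < u + k + 1 - t := by linarith [ht.2]
  have e1 : 1 - (1 - u) * negBranch k t = (u + k + 1 - t) / (k + 2 - t) := by
    unfold negBranch
    field_simp
    ring
  have e2 : 1 - (1 - nextState u k) * t = (u + k + 1 - t) / (u + k + 1) := by
    unfold nextState
    field_simp
    ring
  rw [stateDensity, stateDensity, e1, e2, digitWeight, nextState]
  field_simp

lemma lintegral_stateDensity {u : ℝ} (hu : u ∈ Set.Ioc (0 : ℝ) 1) (F : ℕ → ℝ → ENNReal) :
    ∫⁻ y in Set.Ioo 0 1, ENNReal.ofReal (stateDensity u y) * F (digitExcess y) (negT y) =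
      ∑' k, ENNReal.ofReal (digitWeight u k) *
        ∫⁻ t in Set.Ioo 0 1, ENNReal.ofReal (stateDensity (nextState u k) t) * F k t := by
  rw [← iUnion_negBranch_image, lintegral_iUnion measurableSet_negBranch_image]
  · refine tsum_congr fun k => ?_
    rw [lintegral_image_eq_lintegral_abs_deriv_mul measurableSet_Ico
      (fun t ht => (hasDerivAt_negBranch k ht).hasDerivWithinAt) (injOn_negBranch k),
      iUnion_negBranch_image, ← lintegral_const_mul' _ _ ENNReal.ofReal_ne_top,
      Measure.restrict_congr_set (Ioo_ae_eq_Ico (μ := volume))]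
    refine setLIntegral_congr_fun measurableSet_Ico fun t ht => ?_
    rw [digitExcess_negBranch k ht, negT_negBranch k ht, ← mul_assoc, ← mul_assoc,
      ← ENNReal.ofReal_mul (abs_nonneg _), ← ENNReal.ofReal_mul (digitWeight_nonneg hu.1 k),
      abs_of_nonneg (by positivity), stateDensity_negBranch hu k ht]
  · intro i j hij
    rw [Function.onFun, Set.disjoint_left]
    rintro _ ⟨s, hs, rfl⟩ ⟨t, ht, h⟩
    apply hij
    rw [← digitExcess_negBranch i hs, ← h, digitExcess_negBranch j ht]

lemma lintegral_stateDensity_le_one {u : ℝ} (hu : u ∈ Set.Ioc (0 : ℝ) 1) :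
    ∫⁻ y in Set.Ioo 0 1, ENNReal.ofReal (stateDensity u y) ≤ 1 := by
  set f : ℝ → ℝ := fun y => u * y / (1 - (1 - u) * y) with hf
  have hu0 := hu.1
  have hpos : ∀ y ∈ Set.Ioo (0 : ℝ) 1, 0 < 1 - (1 - u) * y := fun y hy =>
    one_sub_mul_pos hu ⟨hy.1.le, hy.2⟩
  have hd : ∀ y ∈ Set.Ioo (0 : ℝ) 1, HasDerivWithinAt f (stateDensity u y) (Set.Ioo 0 1) y := by
    intro y hy
    have h1 : HasDerivAt (fun y : ℝ => u * y) u y := by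
      simpa using (hasDerivAt_id y).const_mul u
    have h2 : HasDerivAt (fun y : ℝ => 1 - (1 - u) * y) (-(1 - u)) y := by
      simpa using ((hasDerivAt_id y).const_mul (1 - u)).const_sub 1
    have h3 := h1.div h2 (hpos y hy).ne'
    have e : (u * (1 - (1 - u) * y) - u * y * -(1 - u)) / (1 - (1 - u) * y) ^ 2
        = stateDensity u y := by
      rw [stateDensity]; ring_nf
    rw [e] at h3
    exact h3.hasDerivWithinAt
  have hinj : Set.InjOn f (Set.Ioo 0 1) := by
    intro x hx y hy h
    simp only [hf] at h
    rw [div_eq_div_iff (hpos x hx).ne' (hpos y hy).ne'] at h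
    have : u * (x - y) = 0 := by linear_combination h
    rcases mul_eq_zero.1 this with h | h
    · exact absurd h hu0.ne'
    · linarith
  have himg : f '' Set.Ioo 0 1 ⊆ Set.Ioo 0 1 := by
    rintro _ ⟨y, hy, rfl⟩
    have := hpos y hy
    have hy0 := hy.1
    refine ⟨by simp only [hf]; positivity, ?_⟩
    simp only [hf]
    rw [div_lt_one this]
    linarith [hy.2]
  have h := lintegral_image_eq_lintegral_abs_deriv_mul measurableSet_Ioo hd hinj fun _ => 1
  simp only [lintegral_one, Measure.restrict_apply_univ, mul_one] at h
  have e : ∫⁻ y in Set.Ioo 0 1, ENNReal.ofReal (stateDensity u y) =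
      ∫⁻ y in Set.Ioo 0 1, ENNReal.ofReal |stateDensity u y| := by
    refine lintegral_congr fun y => ?_
    rw [abs_of_nonneg (show 0 ≤ stateDensity u y from div_nonneg hu0.le (sq_nonneg _))]
  rw [e, ← h]
  exact (measure_mono himg).trans (by simp)

/-- The state after `n` digits, together with the accumulated value of the additive
functional `z`. -/
noncomputable def digitRun (z : ℝ → ℕ → ℝ) : ℕ → ℝ × ℝ → ℝ → ℝ × ℝ
  | 0, p, _ => p
  | n + 1, p, y => digitRun z n
      (nextState p.1 (digitExcess y), p.2 + z p.1 (digitExcess y)) (negT y)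

lemma measurable_digitRun (z : ℝ → ℕ → ℝ) (n : ℕ) (p : ℝ × ℝ) :
    Measurable (digitRun z n p) := by
  induction n generalizing p with
  | zero => exact measurable_const
  | succ n ih =>
    have h : Measurable fun q : ℝ × ℕ =>
        digitRun z n (nextState p.1 q.2, p.2 + z p.1 q.2) q.1 :=
      measurable_from_prod_countable_left fun k => ih (nextState p.1 k, p.2 + z p.1 k)
    have e : digitRun z (n + 1) p = fun y => digitRun z n
        (nextState p.1 (digitExcess y), p.2 + z p.1 (digitExcess y)) (negT y) := by
      funext y
      rw [digitRun]
    rw [e]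
    clear e
    generalize digitRun z n = D at h ⊢
    exact h.comp (measurable_negT.prodMk measurable_digitExcess)

lemma digitRun_fst_mem {z : ℝ → ℕ → ℝ} {M : ℝ} (n : ℕ) {p : ℝ × ℝ}
    (hp : p.1 ∈ Set.Ioc (0 : ℝ) 1) (hM : 1 / p.1 + n ≤ M) (y : ℝ) :
    (digitRun z n p y).1 ∈ Set.Ioc (0 : ℝ) 1 ∧ 1 / (digitRun z n p y).1 ≤ M := by
  induction n generalizing p y with
  | zero => exact ⟨hp, by simpa [digitRun] using hM⟩
  | succ n ih =>
    refine ih (nextState_mem hp.1 _) ?_ _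
    have := one_div_nextState_le hp.1 (digitExcess y)
    push_cast at hM
    simp only
    linarith

lemma lintegral_digitRun_le {z : ℝ → ℕ → ℝ} {M : ℝ} {F : ℝ → ℝ → ℝ} {Ψ : ℕ → ℝ → ℝ → ℝ}
    (hF : ∀ u a, u ∈ Set.Ioc (0 : ℝ) 1 → F u a ≤ Ψ 0 u a)
    (h0 : ∀ j u a, u ∈ Set.Ioc (0 : ℝ) 1 → 0 ≤ Ψ j u a)
    (hb : ∀ j u a, u ∈ Set.Ioc (0 : ℝ) 1 →
      AbsBounded fun k => Ψ j (nextState u k) (a + z u k))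
    (hstep : ∀ (j : ℕ) (u a : ℝ), u ∈ Set.Ioc (0 : ℝ) 1 → 1 / u + (j + 1) ≤ M →
      digitMean u (fun k => Ψ j (nextState u k) (a + z u k)) ≤ Ψ (j + 1) u a)
    (n : ℕ) {u : ℝ} (hu : u ∈ Set.Ioc (0 : ℝ) 1) (hM : 1 / u + n ≤ M) (a : ℝ) :
    ∫⁻ y in Set.Ioo 0 1, ENNReal.ofReal (stateDensity u y) *
      ENNReal.ofReal (F (digitRun z n (u, a) y).1 (digitRun z n (u, a) y).2) ≤
      ENNReal.ofReal (Ψ n u a) := by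
  induction n generalizing u a with
  | zero =>
    simp only [digitRun]
    rw [lintegral_mul_const' _ _ ENNReal.ofReal_ne_top]
    calc _ ≤ 1 * ENNReal.ofReal (F u a) := by gcongr; exact lintegral_stateDensity_le_one hu
      _ ≤ _ := by rw [one_mul]; exact ENNReal.ofReal_le_ofReal (hF u a hu)
  | succ n ih =>
    push_cast at hM
    rw [show (∫⁻ y in Set.Ioo 0 1, ENNReal.ofReal (stateDensity u y) *
        ENNReal.ofReal (F (digitRun z (n + 1) (u, a) y).1 (digitRun z (n + 1) (u, a) y).2)) = _ from
      lintegral_stateDensity hu fun k t => ENNReal.ofReal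
        (F (digitRun z n (nextState u k, a + z u k) t).1
          (digitRun z n (nextState u k, a + z u k) t).2)]
    calc _ ≤ ∑' k, ENNReal.ofReal (digitWeight u k) *
          ENNReal.ofReal (Ψ n (nextState u k) (a + z u k)) := by
          refine ENNReal.tsum_le_tsum fun k => mul_le_mul_right (ih (nextState_mem hu.1 k) ?_ _) _
          linarith [one_div_nextState_le hu.1 k]
      _ = ENNReal.ofReal (digitMean u fun k => Ψ n (nextState u k) (a + z u k)) := by
          simp_rw [← ENNReal.ofReal_mul (digitWeight_nonneg hu.1 _)]
          exact (ENNReal.ofReal_tsum_of_nonneg (fun k => mul_nonneg (digitWeight_nonneg hu.1 k)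
            (h0 _ _ _ (nextState_mem hu.1 k))) (summable_digitWeight_mul hu.1 (hb n u a hu))).symm
      _ ≤ _ := ENNReal.ofReal_le_ofReal (hstep n u a hu hM)

lemma exists_pow_four_eq {r M : ℝ} (hr : 0 < r) (hM : r ≤ M) :
    ∃ s, 1 ≤ s ∧ M = r * s ^ 4 ∧ log M - log r ≤ 4 * s := by
  have hz : 1 ≤ M / r := by rwa [one_le_div hr]
  have h1 : 1 ≤ √(M / r) := Real.one_le_sqrt.2 hz
  have h2 : 1 ≤ √√(M / r) := Real.one_le_sqrt.2 h1
  have e : √√(M / r) ^ 4 = M / r := by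
    rw [show 4 = 2 * 2 from rfl, pow_mul, Real.sq_sqrt (by positivity), Real.sq_sqrt (by linarith)]
  refine ⟨√√(M / r), h2, by rw [e]; field_simp, ?_⟩
  rw [← log_div (by linarith) hr.ne', ← e, log_pow]
  push_cast
  rw [e]
  linarith [log_le_sub_one_of_pos (show 0 < √√(M / r) by linarith)]

lemma two_mul_sq_le {δ : ℝ} (hδ : 0 < δ) (s : ℝ) : 2 * s ^ 2 ≤ δ * s ^ 4 + 1 / δ := by
  have h : 0 ≤ (δ * s ^ 2 - 1) ^ 2 / δ := by positivity
  have e : (δ * s ^ 2 - 1) ^ 2 / δ = δ * s ^ 4 - 2 * s ^ 2 + 1 / δ := by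
    field_simp
    ring
  linarith

section logPotBound

variable {M δ u : ℝ}

lemma log_one_div_mem (hu : u ∈ Set.Ioc (0 : ℝ) 1) (hM : 1 / u ≤ M) :
    log (1 / u) ∈ Set.Icc 0 (log M) :=
  ⟨log_nonneg (one_le_one_div hu.1 hu.2), log_le_log (one_div_pos.2 hu.1) hM⟩

lemma abs_logPot_le (hu : u ∈ Set.Ioc (0 : ℝ) 1) (hM : 1 / u ≤ M) (hδ : 0 < δ) :
    |logPot (log M) u| ≤ 2 * (δ * M + 1 / u / δ) := by
  have hr : 0 < 1 / u := one_div_pos.2 hu.1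
  obtain ⟨s, hs, e, hs'⟩ := exists_pow_four_eq hr hM
  have h1 := (log_one_div_mem hu hM).2
  have h2 := two_mul_sq_le hδ s
  rw [logPot, abs_mul, abs_of_pos hr, abs_of_nonpos (by linarith)]
  calc 1 / u * -(log (1 / u) - log M) ≤ 1 / u * (2 * (δ * s ^ 4 + 1 / δ)) := by
        gcongr
        nlinarith
    _ = 2 * (δ * (1 / u * s ^ 4) + 1 / u / δ) := by ring
    _ = _ := by rw [← e]

lemma mul_logPot_sq_le (hu : u ∈ Set.Ioc (0 : ℝ) 1) (hM : 1 / u ≤ M) (hδ : 0 < δ) :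
    u * logPot (log M) u ^ 2 ≤ 8 * (δ * M + 1 / u / δ) := by
  have hu0 := hu.1
  have hr : 0 < 1 / u := one_div_pos.2 hu.1
  obtain ⟨s, hs, e, hs'⟩ := exists_pow_four_eq hr hM
  have h1 := (log_one_div_mem hu hM).2
  have h2 := two_mul_sq_le hδ s
  have h3 : (log M - log (1 / u)) ^ 2 ≤ (4 * s) ^ 2 := pow_le_pow_left₀ (by linarith) hs' 2
  calc u * logPot (log M) u ^ 2 = 1 / u * (log M - log (1 / u)) ^ 2 := by
        rw [logPot]; field_simp; ring
    _ ≤ 1 / u * (8 * (δ * s ^ 4 + 1 / δ)) := by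
        gcongr
        nlinarith
    _ = 8 * (δ * (1 / u * s ^ 4) + 1 / u / δ) := by ring
    _ = _ := by rw [← e]

lemma abs_logPot_nextState_zero_sub_le (hu : u ∈ Set.Ioc (0 : ℝ) 1) (hM : 1 / u ≤ M) :
    |logPot (log M) (nextState u 0) - logPot (log M) u| ≤ 2 * (1 + log M) := by
  have hu0 := hu.1
  have h1 := log_one_div_mem hu hM
  have h2 := (one_div_mul_log_mem hu).2
  have h3 := log_le_sub_one_of_pos (show 0 < 1 + u by linarith)
  have h4 : 0 ≤ log (1 + u) := log_nonneg (by linarith)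
  have h5 : 0 ≤ 1 / u * log (1 + u) := by positivity
  rw [logPot_nextState_zero _ hu0, logPot]
  have e : (1 + 1 / u) * (log (1 + u) + log (1 / u) - log M) - 1 / u * (log (1 / u) - log M) =
    log (1 + u) + 1 / u * log (1 + u) + log (1 / u) - log M := by ring
  rw [e, abs_le]
  constructor <;> linarith [h1.1, h1.2, hu.2]

lemma abs_logPot_nextState_succ_le {L : ℝ} (hL : 0 ≤ L) (hu : 0 < u) (k : ℕ) :
    |logPot L (nextState u (k + 1))| ≤ 2 * (1 + L) := by
  have h := one_add_one_div_mem hu k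
  have h1 := mul_log_mem h.1 h.2
  have h2 := mul_le_mul_of_nonneg_left h.2 hL
  have h3 := mul_nonneg hL (zero_le_one.trans h.1)
  rw [logPot_nextState_succ _ hu, abs_le]
  constructor <;> linarith [h1.1, h1.2]

lemma digitMean_logPot_sub_sq_le (hu : u ∈ Set.Ioc (0 : ℝ) 1) (hM : 1 / u ≤ M) (hδ : 0 < δ) :
    digitMean u (fun k => (logPot (log M) (nextState u k) - logPot (log M) u) ^ 2) ≤
      12 * (1 + log M) ^ 2 + 16 * (δ * M + 1 / u / δ) := by
  have hu0 := hu.1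
  have hu1 : 0 < 1 + u := by linarith
  have hL : 0 ≤ log M := log_nonneg ((one_le_one_div hu.1 hu.2).trans hM)
  have h0 := sq_le_sq' (abs_le.1 (abs_logPot_nextState_zero_sub_le hu hM)).1
    (abs_le.1 (abs_logPot_nextState_zero_sub_le hu hM)).2
  have hb : AbsBounded fun k => (logPot (log M) (nextState u k) - logPot (log M) u) ^ 2 :=
    ((absBounded_logPot hL hu0).sub (.const _)).pow 2
  have hs : digitMean (1 + u)
      (fun k => (logPot (log M) (nextState u (k + 1)) - logPot (log M) u) ^ 2) ≤
      8 * (1 + log M) ^ 2 + 2 * logPot (log M) u ^ 2 := by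
    refine (le_abs_self _).trans (abs_digitMean_le hu1 fun k => ?_)
    rw [abs_of_nonneg (sq_nonneg _)]
    have h := sq_le_sq' (abs_le.1 (abs_logPot_nextState_succ_le hL hu0 k)).1
      (abs_le.1 (abs_logPot_nextState_succ_le hL hu0 k)).2
    nlinarith [sq_nonneg (logPot (log M) (nextState u (k + 1)) + logPot (log M) u)]
  have hp := mul_logPot_sq_le hu hM hδ
  have h1 : 1 / (1 + u) ≤ 1 := by rw [div_le_one hu1]; linarith
  have h2 : u / (1 + u) ≤ u := div_le_self hu0.le (by linarith)
  have h3 : u / (1 + u) ≤ 1 := h2.trans hu.2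
  rw [digitMean_eq_zero_add hu0 hb]
  calc _ ≤ 1 / (1 + u) * (2 * (1 + log M)) ^ 2 +
        u / (1 + u) * (8 * (1 + log M) ^ 2 + 2 * logPot (log M) u ^ 2) := by gcongr
    _ = 1 / (1 + u) * (2 * (1 + log M)) ^ 2 + u / (1 + u) * (8 * (1 + log M) ^ 2) +
        u / (1 + u) * (2 * logPot (log M) u ^ 2) := by ring
    _ ≤ 1 * (2 * (1 + log M)) ^ 2 + 1 * (8 * (1 + log M) ^ 2) +
        u * (2 * logPot (log M) u ^ 2) := by gcongr
    _ ≤ _ := by linarith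

end logPotBound

section fluctuation

variable {h : ℝ → ℝ} {C ε δ u : ℝ} {M : ℕ}

/-- The potential `logPot` with its corrector. -/
noncomputable def potential (h : ℝ → ℝ) (L u : ℝ) : ℝ := logPot L u + L * h u

/-- The change of the potential, compensated by the truncated digit. -/
noncomputable def increment (h : ℝ → ℝ) (M : ℕ) (u : ℝ) (k : ℕ) : ℝ :=
  potential h (log M) (nextState u k) - potential h (log M) u - 1 + truncDigit M k

lemma absBounded_potential (hC : ∀ x ∈ Set.Ioc (0 : ℝ) 1, |h x| ≤ C) {L : ℝ} (hL : 0 ≤ L)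
    (hu : 0 < u) : AbsBounded fun k => potential h L (nextState u k) :=
  (absBounded_logPot hL hu).add ((AbsBounded.const _).mul (absBounded_comp_nextState hC hu))

lemma absBounded_increment (hC : ∀ x ∈ Set.Ioc (0 : ℝ) 1, |h x| ≤ C) (hu : 0 < u) :
    AbsBounded (increment h M u) :=
  (((absBounded_potential hC (log_natCast_nonneg M) hu).sub (.const _)).sub (.const _)).add
    (absBounded_truncDigit M)

lemma abs_digitMean_increment_le (hC : ∀ x ∈ Set.Ioc (0 : ℝ) 1, |h x| ≤ C)
    (hcor : ∀ x ∈ Set.Ioc (0 : ℝ) 1,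
      |digitMean x (fun k => h (nextState x k)) - h x - x / (1 + x) * (gaussOp id x - x)| ≤ ε * x)
    (hu : u ∈ Set.Ioc (0 : ℝ) 1) (hM : 1 ≤ M) :
    |digitMean u (increment h M u)| ≤ (4 + ε * log M) * u := by
  have hu0 := hu.1
  have hL : 0 ≤ log M := log_natCast_nonneg M
  have hb1 := absBounded_logPot hL hu0
  have hb2 := (AbsBounded.const (log M)).mul (absBounded_comp_nextState hC hu0)
  have e : digitMean u (increment h M u) =
      digitMean u (fun k => logPot (log M) (nextState u k)) +
        log M * digitMean u (fun k => h (nextState u k)) - (logPot (log M) u + log M * h u) - 1 +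
        digitMean u (truncDigit M) := by
    unfold increment potential
    rw [digitMean_add hu0 (((hb1.add hb2).sub (.const _)).sub (.const _)) (absBounded_truncDigit M),
      digitMean_sub hu0 ((hb1.add hb2).sub (.const _)) (.const _),
      digitMean_sub hu0 (hb1.add hb2) (.const _), digitMean_add hu0 hb1 hb2,
      digitMean_const hu0, digitMean_const hu0, digitMean_const_mul]
  have h1 := one_div_mul_log_mem hu
  have h2 := entropyMean_mem hu0
  have h3 := abs_le.1 (abs_digitMean_truncDigit_sub_le hu hM)
  have h4 := abs_le.1 (hcor u hu)
  have h5 : u / (1 + u) ≤ u := div_le_self hu0.le (by linarith)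
  have h6 : 0 ≤ u / (1 + u) := by positivity
  have h7 : u / (1 + u) * entropyMean u ∈ Set.Icc 0 (2 * u) := by
    refine ⟨mul_nonneg h6 h2.1, ?_⟩
    rw [mul_comm 2 u]
    exact mul_le_mul h5 h2.2 h2.1 hu0.le
  have h8 := mul_le_mul_of_nonneg_left h4.1 hL
  have h9 := mul_le_mul_of_nonneg_left h4.2 hL
  have h10 : u / (1 + u) * (1 + u) = u := by field_simp
  have e2 : digitMean u (increment h M u) = (1 / u * log (1 + u) - 1) +
      u / (1 + u) * entropyMean u + log M * (digitMean u (fun k => h (nextState u k)) - h u -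
        u / (1 + u) * (gaussOp id u - u)) + (digitMean u (truncDigit M) - u * log M) := by
    rw [e, digitMean_logPot hL hu0]
    linear_combination -log M * h10
  rw [e2, abs_le]
  constructor <;> nlinarith [h1.1, h1.2, h3.1, h3.2, h7.1, h7.2]

lemma digitMean_increment_sq_le (hC : ∀ x ∈ Set.Ioc (0 : ℝ) 1, |h x| ≤ C)
    (hu : u ∈ Set.Ioc (0 : ℝ) 1) (hM : 1 / u ≤ M) (hδ : 0 < δ) :
    digitMean u (fun k => increment h M u k ^ 2) ≤
      (36 + 3 * (1 + 2 * C) ^ 2) * (1 + log M) ^ 2 + 48 * (δ * M + 1 / u / δ) + 6 * M * u := by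
  have hu0 := hu.1
  have hL : 0 ≤ log M := log_natCast_nonneg M
  have hC0 : 0 ≤ C := (abs_nonneg _).trans (hC u hu)
  have hb1 : AbsBounded fun k => (logPot (log M) (nextState u k) - logPot (log M) u) ^ 2 :=
    ((absBounded_logPot hL hu0).sub (.const _)).pow 2
  have hb2 := (absBounded_truncDigit M).pow 2
  have hk : ∀ k, increment h M u k ^ 2 ≤
      3 * (logPot (log M) (nextState u k) - logPot (log M) u) ^ 2 +
        3 * ((1 + 2 * C) * (1 + log M)) ^ 2 + 3 * truncDigit M k ^ 2 := by
    intro k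
    have h1 := abs_le.1 (hC _ (nextState_mem hu0 k))
    have h2 := abs_le.1 (hC _ hu)
    have h3 : |log M * (h (nextState u k) - h u) - 1| ≤ (1 + 2 * C) * (1 + log M) := by
      rw [abs_le]
      constructor <;> nlinarith
    have h4 := sq_le_sq' (abs_le.1 h3).1 (abs_le.1 h3).2
    set x := logPot (log M) (nextState u k) - logPot (log M) u
    set y := log M * (h (nextState u k) - h u) - 1
    have e : increment h M u k = x + y + truncDigit M k := by
      simp only [increment, potential, x, y]
      ring
    rw [e]
    nlinarith [sq_nonneg (x - y), sq_nonneg (x - truncDigit M k), sq_nonneg (y - truncDigit M k)]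
  have hb3 := (AbsBounded.const 3).mul hb1
  have hb4 := (AbsBounded.const 3).mul hb2
  have hb5 := AbsBounded.const (3 * ((1 + 2 * C) * (1 + log M)) ^ 2)
  refine (digitMean_mono hu0 ((absBounded_increment hC hu0).pow 2) ((hb3.add hb5).add hb4) hk).trans
    ?_
  rw [digitMean_add hu0 (hb3.add hb5) hb4, digitMean_add hu0 hb3 hb5, digitMean_const hu0,
    digitMean_const_mul, digitMean_const_mul]
  have h1 := digitMean_logPot_sub_sq_le hu hM hδ
  have h2 := digitMean_truncDigit_sq_le hu0 M
  linarith

/-- The centered increment. -/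
noncomputable def centeredIncrement (h : ℝ → ℝ) (M : ℕ) (u : ℝ) (k : ℕ) : ℝ :=
  increment h M u k - digitMean u (increment h M u)

lemma absBounded_centeredIncrement (hC : ∀ x ∈ Set.Ioc (0 : ℝ) 1, |h x| ≤ C) (hu : 0 < u) :
    AbsBounded (centeredIncrement h M u) :=
  (absBounded_increment hC hu).sub (.const _)

lemma digitMean_add_centeredIncrement_sq_le (hC : ∀ x ∈ Set.Ioc (0 : ℝ) 1, |h x| ≤ C)
    (hu : 0 < u) (a : ℝ) :
    digitMean u (fun k => (a + centeredIncrement h M u k) ^ 2) ≤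
      a ^ 2 + digitMean u (fun k => increment h M u k ^ 2) := by
  have hb := absBounded_increment (M := M) hC hu
  set e := digitMean u (increment h M u) with he
  have e1 : (fun k => (a + centeredIncrement h M u k) ^ 2) = fun k =>
      increment h M u k ^ 2 + 2 * (a - e) * increment h M u k + (a - e) ^ 2 := by
    funext k
    rw [centeredIncrement]
    ring
  have hb2 := (AbsBounded.const (2 * (a - e))).mul hb
  rw [e1, digitMean_add hu ((hb.pow 2).add hb2) (.const _), digitMean_add hu (hb.pow 2) hb2,
    digitMean_const hu, digitMean_const_mul, ← he]
  nlinarith [sq_nonneg e]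

end fluctuation

lemma logPot_add_nonneg {M : ℕ} (hM : 1 ≤ M) {u : ℝ} (hu : 0 < u) : 0 ≤ logPot (log M) u + M := by
  have h := neg_logPot_le_exp (log M) hu
  rw [exp_log (by exact_mod_cast hM)] at h
  linarith

/-- The linear combination of potentials used to dominate moments of additive functionals. -/
noncomputable def dominator (α β : ℝ) (M j : ℕ) (u : ℝ) : ℝ :=
  α * (1 / u) + β * (logPot (log M) u + M + j)

section dominator

variable {α β u : ℝ} {M : ℕ}

lemma dominator_nonneg (hα : 0 ≤ α) (hβ : 0 ≤ β) (hM : 1 ≤ M) (j : ℕ) (hu : 0 < u) :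
    0 ≤ dominator α β M j u := by
  have := logPot_add_nonneg hM hu
  unfold dominator
  positivity

lemma absBounded_dominator (α β : ℝ) (M j : ℕ) (hu : 0 < u) :
    AbsBounded fun k => dominator α β M j (nextState u k) :=
  ((AbsBounded.const α).mul (absBounded_one_div_nextState hu)).add
    ((AbsBounded.const β).mul
      (((absBounded_logPot (log_natCast_nonneg M) hu).add (.const _)).add (.const _)))

lemma digitMean_dominator_le (hα : 0 ≤ α) (hβ : 0 ≤ β) (j : ℕ) (hu : u ∈ Set.Ioc (0 : ℝ) 1) :
    digitMean u (fun k => dominator α β M j (nextState u k)) ≤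
      dominator α β M (j + 1) u + (2 * α - β * (log M / 2 - 2)) * u := by
  have hL := log_natCast_nonneg M
  have hb1 := absBounded_one_div_nextState hu.1
  have hb2 := absBounded_logPot hL hu.1
  unfold dominator
  rw [digitMean_add hu.1 ((AbsBounded.const α).mul hb1)
      ((AbsBounded.const β).mul ((hb2.add (.const _)).add (.const _))),
    digitMean_const_mul, digitMean_const_mul, digitMean_add hu.1 (hb2.add (.const _)) (.const _),
    digitMean_add hu.1 hb2 (.const _), digitMean_const hu.1, digitMean_const hu.1]
  have h1 := mul_le_mul_of_nonneg_left (digitMean_one_div_nextState_le hu.1) hα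
  have h2 := mul_le_mul_of_nonneg_left (digitMean_logPot_le hL hu) hβ
  push_cast
  linarith

lemma dominator_one_le (hβ : 0 ≤ β) {n : ℕ} (hn : n ≤ M) :
    dominator α β M n 1 ≤ α + 2 * β * M := by
  have h : (n : ℝ) ≤ M := by exact_mod_cast hn
  have hL := log_natCast_nonneg M
  simp only [dominator, logPot, div_one, log_one]
  nlinarith

end dominator

lemma stateDensity_one (y : ℝ) : stateDensity 1 y = 1 := by simp [stateDensity]

lemma lintegral_digitRun_centeredIncrement_le {h : ℝ → ℝ} {C δ : ℝ} {n M : ℕ}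
    (hC : ∀ x ∈ Set.Ioc (0 : ℝ) 1, |h x| ≤ C) (hδ : 0 < δ) (hM : n + 1 ≤ M) (hL : 4 < log M) :
    ∫⁻ y in Set.Ioo 0 1,
      ENNReal.ofReal ((digitRun (centeredIncrement h M) n (1, 0) y).2 ^ 2) ≤
      ENNReal.ofReal (M * ((36 + 3 * (1 + 2 * C) ^ 2) * (1 + log M) ^ 2 + 48 * δ * M) +
        (48 / δ * M + 2 * ((96 / δ + 6) * M / (log M / 2 - 2)) * M)) := by
  set κ : ℝ := (36 + 3 * (1 + 2 * C) ^ 2) * (1 + log M) ^ 2 + 48 * δ * M with hκ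
  set β : ℝ := (96 / δ + 6) * M / (log M / 2 - 2) with hβ
  have hL' : 0 < log M / 2 - 2 := by linarith
  have hκ0 : 0 ≤ κ := by positivity
  have hβ0 : 0 ≤ β := by positivity
  have hβL : β * (log M / 2 - 2) = (96 / δ + 6) * M := div_mul_cancel₀ _ hL'.ne'
  have hα : ∀ j : ℕ, 0 ≤ 48 / δ * j := fun j => by positivity
  have hM1 : 1 ≤ M := by omega
  have hnM : (n : ℝ) + 1 ≤ M := by exact_mod_cast hM
  have key := lintegral_digitRun_le (z := centeredIncrement h M) (M := M) (F := fun _ a => a ^ 2)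
    (Ψ := fun j u a => a ^ 2 + j * κ + dominator (48 / δ * j) β M j u) ?_ ?_ ?_ ?_ n
    (u := 1) (by simp) (by linarith) 0
  · simp only [stateDensity_one, ENNReal.ofReal_one, one_mul] at key
    refine key.trans (ENNReal.ofReal_le_ofReal ?_)
    have h1 := dominator_one_le (α := 48 / δ * n) hβ0 (show n ≤ M by omega)
    have h2 : (n : ℝ) * κ ≤ M * κ := by gcongr; linarith
    have h3 : 48 / δ * (n : ℝ) ≤ 48 / δ * M := by gcongr; linarith
    linarith
  · intro u a hu
    have := dominator_nonneg (hα 0) hβ0 hM1 0 hu.1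
    push_cast at this ⊢
    linarith
  · intro j u a hu
    have := dominator_nonneg (hα j) hβ0 hM1 j hu.1
    positivity
  · intro j u a hu
    exact ((((AbsBounded.const _).add (absBounded_centeredIncrement hC hu.1)).pow 2).add
      (.const _)).add (absBounded_dominator _ _ _ _ hu.1)
  · intro j u a hu huM
    have hb := ((AbsBounded.const a).add (absBounded_centeredIncrement (M := M) hC hu.1)).pow 2
    have hd := absBounded_dominator (48 / δ * j) β M j hu.1
    have hu1 := one_le_one_div hu.1 hu.2
    have hjM : (j : ℝ) ≤ M := by linarith
    rw [digitMean_add hu.1 (hb.add (.const _)) hd, digitMean_add hu.1 hb (.const _),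
      digitMean_const hu.1]
    have h1 := digitMean_add_centeredIncrement_sq_le (M := M) hC hu.1 a
    have h2 := digitMean_increment_sq_le hC hu (show 1 / u ≤ M by linarith [j.cast_nonneg (α := ℝ)]) hδ
    have h3 := digitMean_dominator_le (M := M) (hα j) hβ0 j hu
    rw [hβL] at h3
    have h4 : 48 / δ * j * u ≤ 48 / δ * M * u := by
      gcongr
      exact hu.1.le
    have h5 : dominator (48 / δ * (j + 1 : ℕ)) β M (j + 1) u =
        dominator (48 / δ * j) β M (j + 1) u + 48 * (1 / u / δ) := by
      simp only [dominator]
      push_cast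
      ring
    have h6 : 96 / δ * M * u = 2 * (48 / δ * M * u) := by ring
    rw [h5]
    push_cast
    linarith

/-- The additive functional that controls the drift and detects digits exceeding `M + 2`. -/
noncomputable def monitor (θ θ' : ℝ) (M : ℕ) (u : ℝ) (k : ℕ) : ℝ :=
  θ * u + θ' * if M + 1 ≤ k then 1 else 0

lemma digitMean_monitor_le {θ θ' u : ℝ} {M : ℕ} (hθ' : 0 ≤ θ') (hu : 0 < u) (hM : 1 ≤ M) :
    digitMean u (monitor θ (θ' * M) M u) ≤ (θ + θ') * u := by
  have hM0 : (0 : ℝ) < M := by exact_mod_cast hM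
  unfold monitor
  rw [digitMean_add hu (.const _) ((AbsBounded.const _).mul (absBounded_indicator _)),
    digitMean_const hu, digitMean_const_mul, digitMean_indicator_ge hu]
  have h : M * (u / (u + (M + 1 : ℕ))) ≤ u := by
    rw [← mul_div_assoc, div_le_iff₀ (by positivity)]
    push_cast
    nlinarith
  nlinarith

lemma lintegral_digitRun_monitor_le {θ θ' τ : ℝ} {n M : ℕ} (hθ : 0 ≤ θ) (hθ' : 0 ≤ θ') (hτ : 0 ≤ τ)
    (hM : n + 1 ≤ M) (hL : 4 < log M) :
    ∫⁻ y in Set.Ioo 0 1, ENNReal.ofReal (|(digitRun (monitor θ (θ' * M) M) n (1, 0) y).2| +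
        τ * (1 / (digitRun (monitor θ (θ' * M) M) n (1, 0) y).1)) ≤
      ENNReal.ofReal (τ + 2 * ((θ + θ' + 2 * τ) / (log M / 2 - 2)) * M) := by
  set β : ℝ := (θ + θ' + 2 * τ) / (log M / 2 - 2) with hβ
  have hL' : 0 < log M / 2 - 2 := by linarith
  have hβ0 : 0 ≤ β := by positivity
  have hβL : β * (log M / 2 - 2) = θ + θ' + 2 * τ := div_mul_cancel₀ _ hL'.ne'
  have hM1 : 1 ≤ M := by omega
  have hnM : (n : ℝ) + 1 ≤ M := by exact_mod_cast hM
  have hz : ∀ u, 0 < u → ∀ k, 0 ≤ monitor θ (θ' * M) M u k := fun u hu k => by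
    unfold monitor
    positivity
  have hzb : ∀ u, AbsBounded (monitor θ (θ' * M) M u) := fun u =>
    (AbsBounded.const _).add ((AbsBounded.const _).mul (absBounded_indicator _))
  have habs : ∀ a u, AbsBounded fun k => |a + monitor θ (θ' * M) M u k| := fun a u => by
    obtain ⟨D, hD⟩ := (AbsBounded.const a).add (hzb u)
    exact ⟨D, fun k => by simpa only [abs_abs] using hD k⟩
  have key := lintegral_digitRun_le (z := monitor θ (θ' * M) M) (M := M)
    (F := fun u a => |a| + τ * (1 / u))
    (Ψ := fun j u a => |a| + dominator τ β M j u) ?_ ?_ ?_ ?_ n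
    (u := 1) (by simp) (by linarith) 0
  · simp only [stateDensity_one, ENNReal.ofReal_one, one_mul] at key
    refine key.trans (ENNReal.ofReal_le_ofReal ?_)
    simpa using dominator_one_le (α := τ) hβ0 (show n ≤ M by omega)
  · intro u a hu
    have := mul_nonneg hβ0 (logPot_add_nonneg hM1 hu.1)
    simp only [dominator]
    push_cast
    linarith
  · intro j u a hu
    have := dominator_nonneg hτ hβ0 hM1 j hu.1
    positivity
  · intro j u a hu
    exact (habs a u).add (absBounded_dominator _ _ _ _ hu.1)
  · intro j u a hu _
    rw [digitMean_add hu.1 (habs a u) (absBounded_dominator _ _ _ _ hu.1)]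
    have h1 : digitMean u (fun k => |a + monitor θ (θ' * M) M u k|) ≤ |a| + (θ + θ') * u := by
      refine (digitMean_mono hu.1 (habs a u) ((AbsBounded.const |a|).add (hzb u)) fun k => ?_).trans
        ?_
      · refine (abs_add_le _ _).trans ?_
        rw [abs_of_nonneg (hz u hu.1 k)]
      · rw [digitMean_add hu.1 (.const _) (hzb u), digitMean_const hu.1]
        linarith [digitMean_monitor_le (θ := θ) hθ' hu.1 hM1]
    have h2 := digitMean_dominator_le (M := M) hτ hβ0 j hu
    rw [hβL] at h2
    linarith

lemma digitRun_centeredIncrement_monitor {h : ℝ → ℝ} {θ θ' : ℝ} {M : ℕ} (hθ : 0 ≤ θ) (hθ' : 0 ≤ θ')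
    (hdrift : ∀ x ∈ Set.Ioc (0 : ℝ) 1, |digitMean x (increment h M x)| ≤ θ * x)
    (n : ℕ) {u : ℝ} (hu : u ∈ Set.Ioc (0 : ℝ) 1) (a b y : ℝ) :
    (digitRun (centeredIncrement h M) n (u, a) y).1 = (digitRun (monitor θ θ' M) n (u, b) y).1 ∧
    b ≤ (digitRun (monitor θ θ' M) n (u, b) y).2 ∧
    (b + θ' ≤ (digitRun (monitor θ θ' M) n (u, b) y).2 ∨
      |∑ i ∈ Finset.range n, (digitExcess (negT^[i] y) : ℝ) - n -
          ((digitRun (centeredIncrement h M) n (u, a) y).2 - a) +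
          potential h (log M) (digitRun (monitor θ θ' M) n (u, b) y).1 - potential h (log M) u| ≤
        (digitRun (monitor θ θ' M) n (u, b) y).2 - b) := by
  induction n generalizing u a b y with
  | zero => simp [digitRun]
  | succ n ih =>
    simp only [digitRun]
    set k := digitExcess y with hk
    obtain ⟨h1, h2, h3⟩ := ih (nextState_mem hu.1 k) (a + centeredIncrement h M u k)
      (b + monitor θ θ' M u k) (negT y)
    have hu0 := hu.1.le
    have hg : 0 ≤ monitor θ θ' M u k := by unfold monitor; positivity
    refine ⟨h1, by linarith, ?_⟩
    rcases h3 with h3 | h3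
    · exact Or.inl (by linarith)
    · by_cases hkM : M + 1 ≤ k
      · have hg' : θ' ≤ monitor θ θ' M u k := by
          rw [monitor, if_pos hkM]
          nlinarith
        exact Or.inl (by linarith)
      · right
        have ht : truncDigit M k = k := by
          rw [truncDigit, min_eq_left (by exact_mod_cast (by omega : k ≤ M))]
        have hg' : monitor θ θ' M u k = θ * u := by rw [monitor, if_neg hkM]; ring
        have hd := hdrift u hu
        have hz : centeredIncrement h M u k = potential h (log M) (nextState u k) -
            potential h (log M) u - 1 + k - digitMean u (increment h M u) := by
          rw [centeredIncrement, increment, ht]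
        rw [hg'] at h3 ⊢
        rw [hz] at h3 ⊢
        rw [Finset.sum_range_succ']
        simp only [Function.iterate_succ_apply, Function.iterate_zero, id, ← hk]
        rw [abs_le] at h3 hd ⊢
        push_cast
        constructor <;> linarith [h3.1, h3.2, hd.1, hd.2]

lemma irrational_negT {y : ℝ} (hy : Irrational y) : Irrational (negT y) := by
  rw [negT_eq, one_div]
  exact hy.inv.intCast_sub _

lemma negT_iterate_mem {y : ℝ} (hy : y ∈ Set.Ioo (0 : ℝ) 1) (hirr : Irrational y) (i : ℕ) :
    negT^[i] y ∈ Set.Ioo (0 : ℝ) 1 := by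
  induction i generalizing y with
  | zero => exact hy
  | succ i ih =>
    rw [Function.iterate_succ_apply]
    have h := irrational_negT hirr
    exact ih ⟨(negT_mem y).1.lt_of_ne' h.ne_zero, (negT_mem y).2⟩ h

lemma negDigit_eq {x : ℝ} (hx : x ∈ Set.Ioo (0 : ℝ) 1) (hirr : Irrational x) (i : ℕ) :
    negDigit x (i + 1) = digitExcess (negT^[i] (1 - x)) + 2 := by
  have h := negT_iterate_mem (y := 1 - x) ⟨by linarith [hx.2], by linarith [hx.1]⟩
    (by simpa using hirr.natCast_sub 1) i
  rw [negDigit, Nat.add_sub_cancel, ceil_eq_digitExcess h]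
  omega

lemma sum_negDigit_eq {x : ℝ} (hx : x ∈ Set.Ioo (0 : ℝ) 1) (hirr : Irrational x) (n : ℕ) :
    ∑ k ∈ Finset.Icc 1 n, (negDigit x k : ℝ) =
      ∑ i ∈ Finset.range n, (digitExcess (negT^[i] (1 - x)) : ℝ) + 2 * n := by
  rw [Finset.range_eq_Ico, ← Finset.Ico_add_one_right_eq_Icc, ← Finset.sum_Ico_add' _ 0 n 1]
  simp_rw [negDigit_eq hx hirr]
  push_cast
  rw [Finset.sum_add_distrib]
  simp
  ring

lemma volume_restrict_ge_le {g : ℝ → ℝ} (hg : Measurable g) {B c : ℝ} (hc : 0 < c)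
    (h : ∫⁻ y in Set.Ioo 0 1, ENNReal.ofReal (g y) ≤ ENNReal.ofReal B) :
    volume.restrict (Set.Ioo 0 1) {y | c ≤ g y} ≤ ENNReal.ofReal (B / c) := by
  have h0 : ENNReal.ofReal c ≠ 0 := by simpa using hc
  have h1 := meas_ge_le_lintegral_div (μ := volume.restrict (Set.Ioo (0 : ℝ) 1))
    hg.ennreal_ofReal.aemeasurable h0 ENNReal.ofReal_ne_top
  rw [ENNReal.ofReal_div_of_pos hc]
  refine (measure_mono fun y hy => ?_).trans (h1.trans (ENNReal.div_le_div_right h _))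
  exact ENNReal.ofReal_le_ofReal hy

lemma abs_potential_le {h : ℝ → ℝ} {C δ M u : ℝ} (hC : ∀ x ∈ Set.Ioc (0 : ℝ) 1, |h x| ≤ C)
    (hδ : 0 < δ) (hu : u ∈ Set.Ioc (0 : ℝ) 1) (hM : 1 / u ≤ M) :
    |potential h (log M) u| ≤ 2 * (δ * M + 1 / u / δ) + C * log M := by
  have hL : 0 ≤ log M := log_nonneg ((one_le_one_div hu.1 hu.2).trans hM)
  refine (abs_add_le _ _).trans (add_le_add (abs_logPot_le hu hM hδ) ?_)
  rw [abs_mul, abs_of_nonneg hL, mul_comm]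
  exact mul_le_mul_of_nonneg_right (hC u hu) hL

lemma abs_potential_one_le {h : ℝ → ℝ} {C L : ℝ} (hC : ∀ x ∈ Set.Ioc (0 : ℝ) 1, |h x| ≤ C)
    (hL : 0 ≤ L) : |potential h L 1| ≤ (1 + C) * L := by
  have h1 := abs_le.1 (hC 1 (by simp))
  simp only [potential, logPot, div_one, log_one]
  rw [abs_le]
  constructor <;> nlinarith

lemma volume_negDigit_mean_le {h : ℝ → ℝ} {C ε ε' δ : ℝ} {n : ℕ} (hε : 0 < ε) (hε' : 0 < ε')
    (hδ : 0 < δ) (hC : ∀ x ∈ Set.Ioc (0 : ℝ) 1, |h x| ≤ C)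
    (hcor : ∀ x ∈ Set.Ioc (0 : ℝ) 1,
      |digitMean x (fun k => h (nextState x k)) - h x - x / (1 + x) * (gaussOp id x - x)| ≤ ε' * x)
    (hn : 1 ≤ n) {M : ℕ} (hM : M = n + 1) (hL : 4 < log M)
    (hdet : 2 * δ * M + (1 + 2 * C) * log M ≤ ε * M / 4) :
    volume {x : ℝ | x ∈ Set.Ioo (0 : ℝ) 1 ∧ Irrational x ∧
        |(1 / n : ℝ) * ∑ k ∈ Finset.Icc 1 n, (negDigit x k : ℝ) - 3| > ε} ≤
      ENNReal.ofReal ((M * ((36 + 3 * (1 + 2 * C) ^ 2) * (1 + log M) ^ 2 + 48 * δ * M) +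
        (48 / δ * M + 2 * ((96 / δ + 6) * M / (log M / 2 - 2)) * M)) / (ε * M / 8) ^ 2) +
      ENNReal.ofReal ((2 / δ +
        2 * ((4 + ε' * log M + ε + 2 * (2 / δ)) / (log M / 2 - 2)) * M) / (ε * M / 8)) := by
  have hM1 : 1 ≤ M := by omega
  have hM0 : (0 : ℝ) < M := by exact_mod_cast hM1
  have hL0 : 0 ≤ log M := log_natCast_nonneg M
  have hc : 0 < ε * M / 8 := by positivity
  have hθ : 0 ≤ 4 + ε' * log M := by positivity
  set θ := 4 + ε' * log M with hθdef
  set S := digitRun (centeredIncrement h M) n (1, 0)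
  set R := digitRun (monitor θ (ε * M) M) n (1, 0)
  have hS : Measurable S := measurable_digitRun _ _ _
  have hR : Measurable R := measurable_digitRun _ _ _
  have hgR : Measurable fun y => |(R y).2| + 2 / δ * (1 / (R y).1) := by fun_prop
  have hgS : Measurable fun y => (S y).2 ^ 2 := by fun_prop
  have b1 := volume_restrict_ge_le hgS (sq_pos_of_pos hc)
    (lintegral_digitRun_centeredIncrement_le hC hδ hM.ge hL)
  have b2 := volume_restrict_ge_le hgR hc
    (lintegral_digitRun_monitor_le hθ hε.le (by positivity) hM.ge hL)
  set E₁ := {y | (ε * M / 8) ^ 2 ≤ (S y).2 ^ 2}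
  set E₂ := {y | ε * M / 8 ≤ |(R y).2| + 2 / δ * (1 / (R y).1)}
  have hE : MeasurableSet (E₁ ∪ E₂) :=
    (measurableSet_le measurable_const hgS).union (measurableSet_le measurable_const hgR)
  have hsub : {x : ℝ | x ∈ Set.Ioo (0 : ℝ) 1 ∧ Irrational x ∧
      |(1 / n : ℝ) * ∑ k ∈ Finset.Icc 1 n, (negDigit x k : ℝ) - 3| > ε} ⊆
      (fun x => 1 - x) ⁻¹' ((E₁ ∪ E₂) ∩ Set.Ioo 0 1) := by
    rintro x ⟨hx, hirr, hdev⟩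
    refine ⟨?_, by linarith [hx.2], by linarith [hx.1]⟩
    by_contra hnot
    simp only [Set.mem_union, not_or, E₁, E₂, Set.mem_ofPred_eq, not_le] at hnot
    obtain ⟨hn1, hn2⟩ := hnot
    have hn0 : (0 : ℝ) < n := by exact_mod_cast hn
    have hMn : (M : ℝ) ≤ 2 * n := by exact_mod_cast (by omega : M ≤ 2 * n)
    have hMn' : (1 : ℝ) / 1 + n ≤ M := by rw [hM]; push_cast; linarith
    have hS1 := abs_lt.1 (abs_lt_of_sq_lt_sq hn1 hc.le)
    obtain ⟨-, hb, hor⟩ := digitRun_centeredIncrement_monitor (h := h) (θ := θ) (θ' := ε * M)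
      (M := M) hθ (by positivity) (fun x hx => abs_digitMean_increment_le hC hcor hx hM1) n
      (u := 1) (by simp) 0 0 (1 - x)
    obtain ⟨hR1, hR2⟩ := digitRun_fst_mem (z := monitor θ (ε * M) M) (M := M) n (p := (1, 0))
      (by simp) hMn' (1 - x)
    have hr0 : 0 < 1 / (R (1 - x)).1 := one_div_pos.2 hR1.1
    have hr1 : 0 < 2 / δ * (1 / (R (1 - x)).1) := by positivity
    rw [abs_of_nonneg hb] at hn2
    rcases hor with hor | hor
    · change 0 + ε * M ≤ (R (1 - x)).2 at hor
      linarith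
    · change |_ - ((S (1 - x)).2 - 0) + potential h (log M) (R (1 - x)).1 - _| ≤
        (R (1 - x)).2 - 0 at hor
      have p1 := abs_le.1 (abs_potential_one_le hC hL0)
      have p2 := abs_le.1 (abs_potential_le hC hδ hR1 hR2)
      change -(2 * (δ * M + 1 / (R (1 - x)).1 / δ) + C * log M) ≤
          potential h (log M) (R (1 - x)).1 ∧ potential h (log M) (R (1 - x)).1 ≤
          2 * (δ * M + 1 / (R (1 - x)).1 / δ) + C * log M at p2
      have e1 : 2 / δ * (1 / (R (1 - x)).1) = 2 * (1 / (R (1 - x)).1 / δ) := by ring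
      rw [sum_negDigit_eq hx hirr] at hdev
      set D := ∑ i ∈ Finset.range n, (digitExcess (negT^[i] (1 - x)) : ℝ)
      have e2 : (1 / n : ℝ) * (D + 2 * n) - 3 = (D - n) / n := by field_simp; ring
      rw [e2, abs_div, abs_of_pos hn0, gt_iff_lt, lt_div_iff₀ hn0] at hdev
      have hor := abs_le.1 hor
      rw [e1] at hn2
      have hεM : ε * M ≤ ε * (2 * n) := by gcongr
      rcases lt_abs.1 hdev with hdev | hdev <;> linarith [hor.1, hor.2, p1.1, p1.2, p2.1, p2.2,
        hS1.1, hS1.2]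
  refine (measure_mono hsub).trans ?_
  rw [(volume.measurePreserving_sub_left (1 : ℝ)).measure_preimage
    (hE.inter measurableSet_Ioo).nullMeasurableSet, ← Measure.restrict_apply hE]
  exact (measure_union_le _ _).trans (add_le_add b1 b2)

lemma tendsto_div_log_sub (c : ℝ) : Tendsto (fun x => c / (log x / 2 - 2)) atTop (nhds 0) :=
  tendsto_const_nhds.div_atTop
    (tendsto_atTop_add_const_right _ _ (tendsto_log_atTop.atTop_div_const two_pos))

lemma tendsto_one_add_log_sq_div : Tendsto (fun x => (1 + log x) ^ 2 / x) atTop (nhds 0) := by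
  have h0 : Tendsto (fun x : ℝ => x⁻¹) atTop (nhds 0) := tendsto_inv_atTop_zero
  have h1 := (isLittleO_pow_log_id_atTop (n := 1)).tendsto_div_nhds_zero
  have h2 := (isLittleO_pow_log_id_atTop (n := 2)).tendsto_div_nhds_zero
  have h := (h0.add (h1.const_mul 2)).add h2
  simp only [mul_zero, add_zero, id, pow_one] at h
  refine h.congr fun x => ?_
  ring

lemma tendsto_second_moment_bound {δ ε : ℝ} (hε : 0 < ε) (K : ℝ) :
    Tendsto (fun x => (x * (K * (1 + log x) ^ 2 + 48 * δ * x) +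
        (48 / δ * x + 2 * ((96 / δ + 6) * x / (log x / 2 - 2)) * x)) / (ε * x / 8) ^ 2)
      atTop (nhds (3072 * δ / ε ^ 2)) := by
  have h := ((((tendsto_one_add_log_sq_div.const_mul K).add_const (48 * δ)).add
    (tendsto_inv_atTop_zero.const_mul (48 / δ))).add
      ((tendsto_div_log_sub (96 / δ + 6)).const_mul 2)).const_mul (64 / ε ^ 2)
  have e : 64 / ε ^ 2 * (K * 0 + 48 * δ + 48 / δ * 0 + 2 * 0) = 3072 * δ / ε ^ 2 := by ring
  rw [e] at h
  refine h.congr' ?_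
  filter_upwards [eventually_gt_atTop 0] with x hx
  field_simp
  ring

lemma tendsto_first_moment_bound {δ ε ε' : ℝ} (hε : 0 < ε) :
    Tendsto (fun x => (2 / δ +
        2 * ((4 + ε' * log x + ε + 2 * (2 / δ)) / (log x / 2 - 2)) * x) / (ε * x / 8))
      atTop (nhds (32 * ε' / ε)) := by
  have h := ((tendsto_inv_atTop_zero.const_mul (2 / δ)).add
    (((tendsto_div_log_sub (4 + 4 * ε' + ε + 2 * (2 / δ))).add_const (2 * ε')).const_mul 2)).const_mul
      (8 / ε)
  have e : 8 / ε * (2 / δ * 0 + 2 * (0 + 2 * ε')) = 32 * ε' / ε := by ring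
  rw [e] at h
  refine h.congr' ?_
  filter_upwards [eventually_gt_atTop 0, tendsto_log_atTop.eventually_gt_atTop 4] with x hx hL
  have hL' : log x / 2 - 2 ≠ 0 := by linarith
  have e2 : (4 + ε' * log x + ε + 2 * (2 / δ)) / (log x / 2 - 2) =
      (4 + 4 * ε' + ε + 2 * (2 / δ)) / (log x / 2 - 2) + 2 * ε' := by
    rw [div_add' _ _ _ hL']
    ring
  rw [e2]
  generalize (4 + 4 * ε' + ε + 2 * (2 / δ)) / (log x / 2 - 2) = t
  field_simp

lemma eventually_log_le_mul (c : ℝ) {η : ℝ} (hη : 0 < η) : ∀ᶠ x in atTop, c * log x ≤ η * x := by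
  have h := ((isLittleO_pow_log_id_atTop (n := 1)).tendsto_div_nhds_zero).const_mul c
  simp only [pow_one, id, mul_zero] at h
  filter_upwards [h.eventually_lt_const hη, eventually_gt_atTop 0] with x hx hx0
  rw [← mul_div_assoc, div_lt_iff₀ hx0] at hx
  exact hx.le

/-- The arithmetic means of the negative continued fraction digits converge to `3`
in (Lebesgue) measure. -/
theorem negDigit_mean_tendsto_three_in_measure :
    ∀ ε > (0 : ℝ), Tendsto
      (fun n : ℕ => volume {x : ℝ | x ∈ Set.Ioo (0 : ℝ) 1 ∧ Irrational x ∧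
        |(1 / n : ℝ) * ∑ k ∈ Finset.Icc 1 n, (negDigit x k : ℝ) - 3| > ε})
      atTop (nhds 0) := by
  intro ε hε
  rw [ENNReal.tendsto_nhds_zero]
  intro η' hη'
  obtain ⟨η, hη0, hη⟩ := ENNReal.lt_iff_exists_nnreal_btwn.1 hη'
  have hη1 : (0 : ℝ) < η := by exact_mod_cast hη0
  obtain ⟨δ, hδ, hδ1, hδ2⟩ : ∃ δ : ℝ, 0 < δ ∧ 2 * δ < ε / 8 ∧ 3072 * δ / ε ^ 2 < η / 2 := by
    refine ⟨min (ε / 17) (η * ε ^ 2 / 6145), by positivity, ?_, ?_⟩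
    · linarith [min_le_left (ε / 17) (η * ε ^ 2 / 6145)]
    · rw [div_lt_iff₀ (by positivity)]
      have : 0 < η * ε ^ 2 := by positivity
      linarith [min_le_right (ε / 17) (η * ε ^ 2 / 6145)]
  obtain ⟨ε', hε', hε'1⟩ : ∃ ε' : ℝ, 0 < ε' ∧ 32 * ε' / ε < η / 2 := by
    refine ⟨η * ε / 65, by positivity, ?_⟩
    rw [div_lt_iff₀ hε]
    have : 0 < η * ε := by positivity
    linarith
  obtain ⟨h, C, hC, hcor⟩ := exists_state_corrector hε'
  have hcast : Tendsto (fun n : ℕ => ((n + 1 : ℕ) : ℝ)) atTop atTop :=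
    tendsto_natCast_atTop_atTop.comp (tendsto_add_atTop_nat 1)
  have hlim := hcast.eventually (((tendsto_second_moment_bound (δ := δ) hε
    (36 + 3 * (1 + 2 * C) ^ 2)).eventually_lt_const hδ2).and
    (((tendsto_first_moment_bound (δ := δ) hε).eventually_lt_const hε'1).and
    ((tendsto_log_atTop.eventually_gt_atTop 4).and
    (eventually_log_le_mul (1 + 2 * C) (show 0 < ε / 8 by positivity)))))
  filter_upwards [hlim, eventually_ge_atTop 1] with n ⟨h1, h2, h3, h4⟩ hn
  have hM0 : (0 : ℝ) ≤ (n + 1 : ℕ) := Nat.cast_nonneg _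
  refine (volume_negDigit_mean_le hε hε' hδ hC hcor hn rfl h3 ?_).trans ?_
  · nlinarith
  · refine (add_le_add (ENNReal.ofReal_le_ofReal h1.le) (ENNReal.ofReal_le_ofReal h2.le)).trans ?_
    rw [← ENNReal.ofReal_add (by positivity) (by positivity), add_halves, ENNReal.ofReal_coe_nnreal]
    exact hη.le
end

section
/- For Lebesgue-almost every irrational x ∈ (0,1), the limit superior of the arithmetic means of the negative continued fraction digits is infinite: limsup_{n→∞} (1/n) ∑_{k=1}^{n} a'_k(x) = ∞. -/
open MeasureTheory Filter Real

/-- The Gauss map `x ↦ 1/x mod 1` of the regular continued fraction. -/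
noncomputable def gaussMap (x : ℝ) : ℝ := Int.fract x⁻¹

/-- The regular continued fraction digits, indexed from `0`. -/
noncomputable def gaussDigit (n : ℕ) (x : ℝ) : ℕ := ⌊(gaussMap^[n] x)⁻¹⌋₊

@[fun_prop]
lemma measurable_gaussMap : Measurable gaussMap := measurable_inv.fract

@[fun_prop]
lemma measurable_gaussDigit (n : ℕ) : Measurable (gaussDigit n) :=
  Nat.measurable_floor.comp (measurable_gaussMap.iterate n).inv

/-- Integration over `[0, 1)` against the density `t ↦ (q + r t)⁻²`, which is the shape of the
densities of all iterated push-forwards of Lebesgue measure restricted to a cylinder. -/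
noncomputable def cylIntegral (q r : ℝ) (f : ℝ → ENNReal) : ENNReal :=
  ∫⁻ t in Set.Ico (0 : ℝ) 1, f t * ENNReal.ofReal (1 / (q + r * t) ^ 2)

lemma cylIntegral_const_mul (q r : ℝ) {c : ENNReal} (hc : c ≠ ⊤) (f : ℝ → ENNReal) :
    cylIntegral q r (fun t => c * f t) = c * cylIntegral q r f := by
  simp only [cylIntegral, mul_assoc]
  exact lintegral_const_mul' c _ hc

lemma floor_inv_add {n : ℕ} {t : ℝ} (ht : t ∈ Set.Ico (0 : ℝ) 1) :
    ⌊(((n : ℝ) + 1 + t)⁻¹)⁻¹⌋₊ = n + 1 := by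
  rw [inv_inv, Nat.floor_eq_iff (by have := ht.1; positivity)]
  push_cast
  exact ⟨by linarith [ht.1], by linarith [ht.2]⟩

lemma gaussMap_inv_add {n : ℕ} {t : ℝ} (ht : t ∈ Set.Ico (0 : ℝ) 1) :
    gaussMap ((n : ℝ) + 1 + t)⁻¹ = t := by
  have : (n : ℝ) + 1 + t = ((n + 1 : ℕ) : ℝ) + t := by push_cast; ring
  rw [gaussMap, inv_inv, this, Int.fract_natCast_add, Int.fract_eq_self.2 ht]

lemma Ioc_eq_iUnion_image :
    Set.Ioc (0 : ℝ) 1 = ⋃ n : ℕ, (fun t : ℝ => ((n : ℝ) + 1 + t)⁻¹) '' Set.Ico (0 : ℝ) 1 := by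
  ext x
  simp only [Set.mem_iUnion, Set.mem_image]
  constructor
  · rintro ⟨h0, h1⟩
    have h2 : 1 ≤ ⌊x⁻¹⌋₊ := (Nat.one_le_floor_iff _).2 ((one_le_inv₀ h0).2 h1)
    refine ⟨⌊x⁻¹⌋₊ - 1, x⁻¹ - ⌊x⁻¹⌋₊, ⟨?_, ?_⟩, ?_⟩
    · linarith [Nat.floor_le (inv_pos.2 h0).le]
    · linarith [Nat.lt_floor_add_one x⁻¹]
    · push_cast [h2]
      rw [sub_add_cancel, add_sub_cancel, inv_inv]
  · rintro ⟨n, t, ht, rfl⟩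
    have h0 := ht.1
    exact ⟨by positivity, inv_le_one_of_one_le₀ (by linarith [n.cast_nonneg (α := ℝ)])⟩

lemma injOn_inv_add (n : ℕ) :
    Set.InjOn (fun t : ℝ => ((n : ℝ) + 1 + t)⁻¹) (Set.Ico (0 : ℝ) 1) := fun s _ t _ h => by
  simpa using h

/-- Decomposition of an integral along the first regular continued fraction digit. -/
lemma cylIntegral_eq_tsum {q r : ℝ} (hq : 0 < q) (hr : 0 ≤ r) (f : ℕ → ℝ → ENNReal) :
    cylIntegral q r (fun x => f ⌊x⁻¹⌋₊ (gaussMap x)) =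
      ∑' n : ℕ, cylIntegral (q * (n + 1) + r) q (f (n + 1)) := by
  have hderiv : ∀ n : ℕ, ∀ t ∈ Set.Ico (0 : ℝ) 1,
      HasDerivWithinAt (fun t : ℝ => ((n : ℝ) + 1 + t)⁻¹) (-1 / ((n : ℝ) + 1 + t) ^ 2)
        (Set.Ico (0 : ℝ) 1) t := fun n t ht => by
    have h0 := ht.1
    exact (((hasDerivAt_id t).const_add ((n : ℝ) + 1)).inv (by simp; positivity)).hasDerivWithinAt
  have hmeas : ∀ n : ℕ,
      MeasurableSet ((fun t : ℝ => ((n : ℝ) + 1 + t)⁻¹) '' Set.Ico (0 : ℝ) 1) := fun n =>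
    measurableSet_Ico.image_of_measurable_injOn (by fun_prop) (injOn_inv_add n)
  have hdisj : Pairwise (Function.onFun Disjoint
      fun n : ℕ => (fun t : ℝ => ((n : ℝ) + 1 + t)⁻¹) '' Set.Ico (0 : ℝ) 1) := by
    intro m n hmn
    rw [Function.onFun, Set.disjoint_left]
    rintro x ⟨s, hs, rfl⟩ ⟨t, ht, h⟩
    have := congrArg (fun y : ℝ => ⌊y⁻¹⌋₊) h
    simp only [floor_inv_add hs, floor_inv_add ht] at this
    omega
  rw [cylIntegral, setLIntegral_congr Ico_ae_eq_Ioc, Ioc_eq_iUnion_image,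
    lintegral_iUnion hmeas hdisj]
  refine tsum_congr fun n => ?_
  rw [lintegral_image_eq_lintegral_abs_deriv_mul measurableSet_Ico (hderiv n) (injOn_inv_add n)]
  refine setLIntegral_congr_fun measurableSet_Ico fun t ht => ?_
  have h0 := ht.1
  simp only [floor_inv_add ht, gaussMap_inv_add ht]
  rw [mul_left_comm, ← ENNReal.ofReal_mul (abs_nonneg _)]
  congr 2
  rw [abs_div, abs_neg, abs_one, abs_of_nonneg (by positivity)]
  field_simp
  ring

lemma lintegral_density {q r u v : ℝ} (hq : 0 < q) (hr : 0 ≤ r) (hu : 0 ≤ u) (huv : u ≤ v) :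
    ∫⁻ t in Set.Ioc u v, ENNReal.ofReal (1 / (q + r * t) ^ 2) =
      ENNReal.ofReal (v / (q * (q + r * v)) - u / (q * (q + r * u))) := by
  have hcont : ContinuousOn (fun t : ℝ => 1 / (q + r * t) ^ 2) (Set.Icc u v) := by
    refine ContinuousOn.div (by fun_prop) (by fun_prop) fun t ht => ?_
    have := hu.trans ht.1
    positivity
  have hint := intervalIntegral.integral_eq_sub_of_hasDerivAt
    (f := fun t => t / (q * (q + r * t))) (f' := fun t => 1 / (q + r * t) ^ 2) (a := u) (b := v)
    (fun t ht => by
      rw [Set.uIcc_of_le huv] at ht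
      have h0 := hu.trans ht.1
      have hne : q * (q + r * t) ≠ 0 := by positivity
      have := (hasDerivAt_id t).div (((hasDerivAt_id t).const_mul r).const_add q |>.const_mul q) hne
      refine this.congr_deriv ?_
      simp only [id]
      field_simp
      ring)
    (by rw [← Set.uIcc_of_le huv] at hcont; exact hcont.intervalIntegrable)
  rw [← hint, intervalIntegral.integral_of_le huv, ofReal_integral_eq_lintegral_ofReal]
  · exact (hcont.integrableOn_Icc).mono_set Set.Ioc_subset_Icc_self
  · exact Filter.Eventually.of_forall fun t => by positivity

lemma cylIntegral_one {q r : ℝ} (hq : 0 < q) (hr : 0 ≤ r) :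
    cylIntegral q r (fun _ => 1) = ENNReal.ofReal (1 / (q * (q + r))) := by
  simp only [cylIntegral, one_mul]
  rw [setLIntegral_congr Ico_ae_eq_Ioc, lintegral_density hq hr le_rfl zero_le_one]
  simp

lemma cylIntegral_digit_lt_le {q r : ℝ} (hq : 0 < q) (hr : 0 ≤ r) {m : ℕ}
    (hm : 1 ≤ m) :
    cylIntegral q r (fun x => if gaussDigit 0 x < m then 1 else 0) ≤
      ENNReal.ofReal (1 - 1 / m) * cylIntegral q r (fun _ => 1) := by
  have hm' : (1 : ℝ) ≤ m := by exact_mod_cast hm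
  have h1m : (1 : ℝ) / m ≤ 1 := by rw [div_le_one (by linarith)]; exact hm'
  calc cylIntegral q r (fun x => if gaussDigit 0 x < m then 1 else 0)
      ≤ ∫⁻ t in Set.Ioc (0 : ℝ) 1, (Set.Ioc (1 / (m : ℝ)) 1).indicator
          (fun t => ENNReal.ofReal (1 / (q + r * t) ^ 2)) t := by
        rw [cylIntegral, setLIntegral_congr Ico_ae_eq_Ioc]
        refine setLIntegral_mono' measurableSet_Ioc fun t ht => ?_
        split_ifs with h
        · rw [Set.indicator_of_mem, one_mul]
          refine ⟨?_, ht.2⟩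
          have h2 : t⁻¹ < m := (Nat.floor_lt (inv_pos.2 ht.1).le).1 h
          rw [one_div]
          exact (inv_lt_comm₀ ht.1 (by linarith)).1 h2
        · simp
    _ ≤ ∫⁻ t in Set.Ioc (1 / (m : ℝ)) 1, ENNReal.ofReal (1 / (q + r * t) ^ 2) := by
        rw [lintegral_indicator measurableSet_Ioc]
        exact lintegral_mono' (by
          rw [Measure.restrict_restrict measurableSet_Ioc]
          exact Measure.restrict_mono Set.inter_subset_left le_rfl) le_rfl
    _ ≤ _ := by
        rw [lintegral_density hq hr (by positivity) h1m, cylIntegral_one hq hr,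
          ← ENNReal.ofReal_mul (by linarith)]
        apply ENNReal.ofReal_le_ofReal
        have h3 : 1 / (m : ℝ) * (1 / (q * (q + r))) ≤ 1 / (m : ℝ) / (q * (q + r * (1 / m))) := by
          rw [div_eq_mul_one_div (1 / (m : ℝ))]
          gcongr
          nlinarith
        rw [mul_one, sub_mul, one_mul]
        linarith

lemma cylIntegral_le_digit_le {q r : ℝ} (hq : 0 < q) (hr : 0 ≤ r) (hrq : r ≤ q) {m : ℕ}
    (hm : 1 ≤ m) :
    cylIntegral q r (fun x => if m ≤ gaussDigit 0 x then 1 else 0) ≤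
      ENNReal.ofReal (2 / m) * cylIntegral q r (fun _ => 1) := by
  have hm' : (1 : ℝ) ≤ m := by exact_mod_cast hm
  have h1m : (1 : ℝ) / m ≤ 1 := by rw [div_le_one (by linarith)]; exact hm'
  calc cylIntegral q r (fun x => if m ≤ gaussDigit 0 x then 1 else 0)
      ≤ ∫⁻ t in Set.Ioc (0 : ℝ) 1, (Set.Ioc 0 (1 / (m : ℝ))).indicator
          (fun t => ENNReal.ofReal (1 / (q + r * t) ^ 2)) t := by
        rw [cylIntegral, setLIntegral_congr Ico_ae_eq_Ioc]
        refine setLIntegral_mono' measurableSet_Ioc fun t ht => ?_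
        split_ifs with h
        · rw [Set.indicator_of_mem, one_mul]
          refine ⟨ht.1, ?_⟩
          have h2 : (m : ℝ) ≤ t⁻¹ := (Nat.le_floor_iff (inv_pos.2 ht.1).le).1 h
          rw [one_div]
          exact (le_inv_comm₀ (by linarith) ht.1).1 h2
        · simp
    _ ≤ ∫⁻ t in Set.Ioc 0 (1 / (m : ℝ)), ENNReal.ofReal (1 / (q + r * t) ^ 2) := by
        rw [lintegral_indicator measurableSet_Ioc]
        exact lintegral_mono' (by
          rw [Measure.restrict_restrict measurableSet_Ioc]
          exact Measure.restrict_mono Set.inter_subset_left le_rfl) le_rfl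
    _ ≤ _ := by
        rw [lintegral_density hq hr le_rfl (by positivity), cylIntegral_one hq hr,
          ← ENNReal.ofReal_mul (by positivity)]
        apply ENNReal.ofReal_le_ofReal
        rw [zero_div, sub_zero, div_eq_mul_one_div (1 / (m : ℝ)),
          show (2 : ℝ) / m * (1 / (q * (q + r))) = 1 / m * (2 / (q * (q + r))) by ring]
        gcongr ?_ * ?_
        rw [div_le_div_iff₀ (by positivity) (by positivity)]
        have : 0 ≤ q * (r * (1 / m)) := by positivity
        nlinarith

lemma cylIntegral_one_eq_tsum {q r : ℝ} (hq : 0 < q) (hr : 0 ≤ r) :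
    ∑' n : ℕ, cylIntegral (q * (n + 1) + r) q (fun _ => 1) = cylIntegral q r (fun _ => 1) :=
  (cylIntegral_eq_tsum hq hr fun _ _ => 1).symm

/-- An estimate for the law of the first digit, uniform in the density, holds for all digits. -/
lemma cylIntegral_comp_digit_le {h : ℕ → ENNReal} {C : ENNReal}
    (hC : ∀ q r : ℝ, 0 < q → 0 ≤ r → r ≤ q →
      cylIntegral q r (fun x => h (gaussDigit 0 x)) ≤ C * cylIntegral q r (fun _ => 1)) (n : ℕ) :
    ∀ q r : ℝ, 0 < q → 0 ≤ r → r ≤ q →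
      cylIntegral q r (fun x => h (gaussDigit n x)) ≤ C * cylIntegral q r (fun _ => 1) := by
  induction n with
  | zero => exact hC
  | succ n ih =>
    intro q r hq hr hrq
    have hq' : ∀ k : ℕ, q ≤ q * (k + 1) + r := fun k => by
      nlinarith [mul_nonneg hq.le (k.cast_nonneg (α := ℝ))]
    calc cylIntegral q r (fun x => h (gaussDigit (n + 1) x))
        = ∑' k : ℕ, cylIntegral (q * (k + 1) + r) q (fun x => h (gaussDigit n x)) :=
          cylIntegral_eq_tsum hq hr fun _ t => h (gaussDigit n t)
      _ ≤ ∑' k : ℕ, C * cylIntegral (q * (k + 1) + r) q (fun _ => 1) :=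
          ENNReal.tsum_le_tsum fun k => ih _ _ (hq.trans_le (hq' k)) hq.le (hq' k)
      _ = _ := by rw [ENNReal.tsum_mul_left, cylIntegral_one_eq_tsum hq hr]

/-- The sum of the first `k` regular continued fraction digits with even index (that is, of the
digits in odd position). -/
noncomputable def evenDigitSum (k : ℕ) (x : ℝ) : ℕ := ∑ j ∈ Finset.range k, gaussDigit (2 * j) x

lemma evenDigitSum_zero (x : ℝ) : evenDigitSum 0 x = 0 := rfl

lemma evenDigitSum_succ (k : ℕ) (x : ℝ) :
    evenDigitSum (k + 1) x = gaussDigit 0 x + evenDigitSum k (gaussMap (gaussMap x)) := by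
  rw [evenDigitSum, Finset.sum_range_succ', add_comm]
  rfl

@[fun_prop]
lemma measurable_evenDigitSum (k : ℕ) : Measurable (evenDigitSum k) := by
  unfold evenDigitSum
  exact Finset.measurable_fun_sum _ fun j _ => measurable_gaussDigit _

/-- A multiplicative functional that vanishes as soon as some digit of odd index is at least `M`
times the sum (started at `S`) of the preceding digits of even index. -/
noncomputable def survivalWeight (M : ℕ) : ℕ → ℕ → ℝ → ENNReal
  | 0, _, _ => 1
  | K + 1, S, x =>
    if gaussDigit 0 (gaussMap x) < M * (S + gaussDigit 0 x) then
      ENNReal.ofReal (exp (1 / (M * (S + gaussDigit 0 x) : ℕ))) *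
        survivalWeight M K (S + gaussDigit 0 x) (gaussMap (gaussMap x))
    else 0

lemma measurable_survivalWeight (M K : ℕ) :
    Measurable fun p : ℕ × ℝ => survivalWeight M K p.1 p.2 := by
  induction K with
  | zero => exact measurable_const
  | succ K ih =>
    have h0 : Measurable fun p : ℕ × ℝ => p.1 + gaussDigit 0 p.2 :=
      measurable_fst.add ((measurable_gaussDigit 0).comp measurable_snd)
    have h1 : Measurable fun p : ℕ × ℝ => gaussMap p.2 := measurable_gaussMap.comp measurable_snd
    refine Measurable.ite ?_ (Measurable.mul ?_ ?_) measurable_const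
    · exact measurableSet_lt ((measurable_gaussDigit 0).comp h1) (h0.const_mul M)
    · exact (measurable_from_nat (f := fun n : ℕ => ENNReal.ofReal (exp (1 / (M * n : ℕ))))).comp h0
    · exact ih.comp (h0.prodMk (measurable_gaussMap.comp h1))

lemma survivalWeight_eq (M K : ℕ) : ∀ (S : ℕ) (x : ℝ),
    (∀ k < K, gaussDigit (2 * k + 1) x < M * (S + evenDigitSum (k + 1) x)) →
    survivalWeight M K S x = ENNReal.ofReal
      (exp (∑ k ∈ Finset.range K, 1 / (M * (S + evenDigitSum (k + 1) x) : ℕ))) := by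
  induction K with
  | zero => simp [survivalWeight]
  | succ K ih =>
    intro S x h
    have h0 : gaussDigit 0 (gaussMap x) < M * (S + gaussDigit 0 x) := by
      have := h 0 K.succ_pos
      rwa [evenDigitSum_succ, evenDigitSum_zero] at this
    rw [survivalWeight, if_pos h0, ih, ← ENNReal.ofReal_mul (exp_nonneg _), ← exp_add,
      Finset.sum_range_succ' _ K, add_comm]
    · simp only [evenDigitSum_succ _ x, evenDigitSum_zero, add_zero, ← add_assoc]
    · intro k hk
      have := h (k + 1) (by omega)
      rwa [evenDigitSum_succ, ← add_assoc] at this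

lemma cylIntegral_survivalWeight_le {M : ℕ} (hM : 1 ≤ M) (K : ℕ) :
    ∀ (S : ℕ) (q r : ℝ), 0 < q → 0 ≤ r →
      cylIntegral q r (survivalWeight M K S) ≤ cylIntegral q r (fun _ => 1) := by
  induction K with
  | zero => exact fun _ _ _ _ _ => le_rfl
  | succ K ih =>
    intro S q r hq hr
    refine (cylIntegral_eq_tsum hq hr fun a t =>
      if gaussDigit 0 t < M * (S + a) then ENNReal.ofReal (exp (1 / (M * (S + a) : ℕ))) *
        survivalWeight M K (S + a) (gaussMap t) else 0).trans_le ?_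
    rw [← cylIntegral_one_eq_tsum hq hr]
    refine ENNReal.tsum_le_tsum fun n => ?_
    have hq' : 0 < q * (n + 1) + r := by positivity
    set Q := q * (n + 1) + r
    obtain ⟨m, hm⟩ : ∃ m, m = M * (S + (n + 1)) := ⟨_, rfl⟩
    have hm1 : 1 ≤ m := hm ▸ Nat.mul_pos hM (by omega)
    rw [← hm]
    set e := ENNReal.ofReal (exp (1 / (m : ℝ))) with he
    calc _ = ∑' b : ℕ, cylIntegral (Q * (b + 1) + q) Q (fun t =>
            if b + 1 < m then e * survivalWeight M K (S + (n + 1)) t else 0) :=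
          cylIntegral_eq_tsum hq' hq.le fun b t =>
            if b < m then e * survivalWeight M K (S + (n + 1)) t else 0
      _ ≤ ∑' b : ℕ, cylIntegral (Q * (b + 1) + q) Q (fun _ => if b + 1 < m then e * 1 else 0) := by
          refine ENNReal.tsum_le_tsum fun b => ?_
          split_ifs
          · rw [cylIntegral_const_mul _ _ ENNReal.ofReal_ne_top,
              cylIntegral_const_mul _ _ ENNReal.ofReal_ne_top]
            gcongr
            exact ih _ _ _ (by positivity) hq'.le
          · rfl
      _ = cylIntegral Q q (fun t => e * if gaussDigit 0 t < m then 1 else 0) := by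
          refine (cylIntegral_eq_tsum hq' hq.le fun b _ => if b < m then e * 1 else 0).symm.trans ?_
          congr 1
          funext t
          rw [mul_ite, mul_zero]
          rfl
      _ ≤ e * (ENNReal.ofReal (1 - 1 / m) * cylIntegral Q q (fun _ => 1)) := by
          rw [cylIntegral_const_mul _ _ ENNReal.ofReal_ne_top]
          gcongr
          exact cylIntegral_digit_lt_le hq' hq.le hm1
      _ ≤ 1 * cylIntegral Q q (fun _ => 1) := by
          rw [← mul_assoc, he, ← ENNReal.ofReal_mul (exp_nonneg _)]
          gcongr
          rw [← ENNReal.ofReal_one]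
          apply ENNReal.ofReal_le_ofReal
          calc exp (1 / (m : ℝ)) * (1 - 1 / m) ≤ exp (1 / (m : ℝ)) * exp (-(1 / m)) := by
                gcongr
                exact one_sub_le_exp_neg _
            _ = 1 := by rw [← exp_add, add_neg_cancel, exp_zero]
      _ = _ := one_mul _

lemma cylIntegral_one_zero (f : ℝ → ENNReal) :
    cylIntegral 1 0 f = ∫⁻ t in Set.Ico (0 : ℝ) 1, f t := by
  simp [cylIntegral]

/-- Almost surely, either some digit of odd index is at least `M` times the sum of the preceding
digits of even index, or these sums grow so fast that their reciprocals are summable. -/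
lemma ae_exists_digit_ge_or_summable {M : ℕ} (hM : 1 ≤ M) :
    ∀ᵐ x ∂(volume.restrict (Set.Ico (0 : ℝ) 1)),
      (∃ k, M * evenDigitSum (k + 1) x ≤ gaussDigit (2 * k + 1) x) ∨
        Summable fun k => (1 : ℝ) / evenDigitSum k x := by
  have hmeas : ∀ K, Measurable (survivalWeight M K 0) := fun K =>
    (measurable_survivalWeight M K).comp (measurable_const.prodMk measurable_id)
  have hbound : ∫⁻ x in Set.Ico (0 : ℝ) 1,
      liminf (fun K => survivalWeight M K 0 x) atTop ≠ ⊤ := by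
    refine ne_top_of_le_ne_top ENNReal.one_ne_top ((lintegral_liminf_le hmeas).trans ?_)
    refine (liminf_le_liminf (v := fun _ => 1) (Eventually.of_forall fun K => ?_)).trans
      (liminf_const _).le
    have := cylIntegral_survivalWeight_le hM K 0 1 0 one_pos le_rfl
    rwa [cylIntegral_one_zero, cylIntegral_one one_pos le_rfl, add_zero, mul_one, div_one,
      ENNReal.ofReal_one] at this
  filter_upwards [ae_lt_top (Measurable.liminf hmeas) hbound] with x hx
  by_contra! hcon
  obtain ⟨h1, h2⟩ := hcon
  refine hx.ne (Tendsto.liminf_eq ?_)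
  have h3 : ¬ Summable fun k => (1 : ℝ) / (M * (0 + evenDigitSum (k + 1) x) : ℕ) := by
    intro h
    refine h2 ((summable_nat_add_iff 1).1 ((h.mul_left (M : ℝ)).congr fun k => ?_))
    have : (M : ℝ) ≠ 0 := by positivity
    push_cast
    rw [zero_add, one_div, mul_inv, ← mul_assoc, mul_inv_cancel₀ this, one_mul, one_div]
  rw [not_summable_iff_tendsto_nat_atTop_of_nonneg fun k => by positivity] at h3
  refine (ENNReal.tendsto_ofReal_nhds_top.2 (tendsto_exp_atTop.comp h3)).congr fun K => ?_
  rw [survivalWeight_eq _ _ _ _ fun k _ => by simpa using h1 k]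
  rfl

lemma volume_le_digit_le (n : ℕ) {m : ℕ} (hm : 1 ≤ m) :
    volume.restrict (Set.Ico (0 : ℝ) 1) {x | m ≤ gaussDigit n x} ≤ ENNReal.ofReal (2 / m) := by
  have h := cylIntegral_comp_digit_le (h := fun a => if m ≤ a then 1 else 0)
    (fun q r hq hr hrq => cylIntegral_le_digit_le hq hr hrq hm) n 1 0 one_pos le_rfl zero_le_one
  rw [cylIntegral_one_zero, cylIntegral_one one_pos le_rfl, add_zero, mul_one, div_one,
    ENNReal.ofReal_one, mul_one] at h
  rw [← lintegral_indicator_one (measurableSet_le measurable_const (measurable_gaussDigit n))]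
  simpa only [Set.indicator_apply, Set.mem_ofPred_eq, Pi.one_apply] using h

lemma min_eq_sum_ite (a T : ℕ) : min a T = ∑ m ∈ Finset.Icc 1 T, if m ≤ a then 1 else 0 := by
  rw [← Finset.card_filter]
  have : (Finset.Icc 1 T).filter (· ≤ a) = Finset.Icc 1 (min a T) := by
    ext m
    simp only [Finset.mem_filter, Finset.mem_Icc, le_min_iff]
    tauto
  rw [this, Nat.card_Icc, Nat.add_sub_cancel]

lemma lintegral_min_digit_le (n T : ℕ) :
    ∫⁻ x in Set.Ico (0 : ℝ) 1, ((min (gaussDigit n x) T : ℕ) : ENNReal) ≤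
      ENNReal.ofReal (2 * (1 + log T)) := by
  calc ∫⁻ x in Set.Ico (0 : ℝ) 1, ((min (gaussDigit n x) T : ℕ) : ENNReal)
      = ∫⁻ x in Set.Ico (0 : ℝ) 1, ∑ m ∈ Finset.Icc 1 T,
          {x | m ≤ gaussDigit n x}.indicator 1 x := by
        refine lintegral_congr fun x => ?_
        rw [min_eq_sum_ite]
        simp [Set.indicator_apply]
    _ = ∑ m ∈ Finset.Icc 1 T, volume.restrict (Set.Ico (0 : ℝ) 1) {x | m ≤ gaussDigit n x} := by
        have hmeas (m : ℕ) : MeasurableSet {x | m ≤ gaussDigit n x} :=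
          measurableSet_le measurable_const (measurable_gaussDigit n)
        rw [lintegral_finsetSum _ fun m _ => measurable_one.indicator (hmeas m)]
        exact Finset.sum_congr rfl fun m _ => lintegral_indicator_one (hmeas m)
    _ ≤ ∑ m ∈ Finset.Icc 1 T, ENNReal.ofReal (2 / m) :=
        Finset.sum_le_sum fun m hm => volume_le_digit_le n (Finset.mem_Icc.1 hm).1
    _ = ENNReal.ofReal (∑ m ∈ Finset.Icc 1 T, 2 / (m : ℝ)) :=
        (ENNReal.ofReal_sum_of_nonneg fun m _ => by positivity).symm
    _ ≤ _ := by
        apply ENNReal.ofReal_le_ofReal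
        have := harmonic_le_one_add_log T
        rw [harmonic_eq_sum_Icc] at this
        push_cast at this
        simp only [div_eq_mul_inv, ← Finset.mul_sum]
        linarith

/-- The sum of the first `2 ^ j` digits of even index is `O(j 2 ^ j)` up to small probability. -/
lemma volume_lt_evenDigitSum_le {A : ℕ} (hA : 1 ≤ A) (j : ℕ) :
    volume.restrict (Set.Ico (0 : ℝ) 1) {x | A ^ 2 * (j + 1) * 2 ^ j < evenDigitSum (2 ^ j) x} ≤
      ENNReal.ofReal (4 / A) := by
  set μ := volume.restrict (Set.Ico (0 : ℝ) 1)
  have hA' : (1 : ℝ) ≤ A := by exact_mod_cast hA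
  have hT : 1 ≤ A * 2 ^ j := Nat.mul_pos hA (by positivity)
  have hD : 0 < A ^ 2 * (j + 1) * 2 ^ j := by positivity
  have hsub : {x | A ^ 2 * (j + 1) * 2 ^ j < evenDigitSum (2 ^ j) x} ⊆
      (⋃ i ∈ Finset.range (2 ^ j), {x | A * 2 ^ j ≤ gaussDigit (2 * i) x}) ∪
      {x | ((A ^ 2 * (j + 1) * 2 ^ j : ℕ) : ENNReal) ≤
        ∑ i ∈ Finset.range (2 ^ j), ((min (gaussDigit (2 * i) x) (A * 2 ^ j) : ℕ) : ENNReal)} := by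
    intro x hx
    by_cases h : ∃ i ∈ Finset.range (2 ^ j), A * 2 ^ j ≤ gaussDigit (2 * i) x
    · left
      simpa using h
    · right
      push Not at h
      rw [Set.mem_ofPred_eq, ← Nat.cast_sum, Nat.cast_le,
        Finset.sum_congr rfl fun i hi => min_eq_left (h i hi).le]
      exact le_of_lt hx
  have h1 : μ (⋃ i ∈ Finset.range (2 ^ j), {x | A * 2 ^ j ≤ gaussDigit (2 * i) x}) ≤
      ENNReal.ofReal (2 / A) := by
    refine (measure_biUnion_finset_le _ _).trans
      ((Finset.sum_le_sum fun i _ => volume_le_digit_le (2 * i) hT).trans ?_)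
    rw [Finset.sum_const, Finset.card_range, nsmul_eq_mul, ← ENNReal.ofReal_natCast,
      ← ENNReal.ofReal_mul (by positivity)]
    apply ENNReal.ofReal_le_ofReal
    push_cast
    apply le_of_eq
    field_simp
  have h2 : μ {x | ((A ^ 2 * (j + 1) * 2 ^ j : ℕ) : ENNReal) ≤
        ∑ i ∈ Finset.range (2 ^ j), ((min (gaussDigit (2 * i) x) (A * 2 ^ j) : ℕ) : ENNReal)} ≤
      ENNReal.ofReal (2 / A) := by
    have hmeas (i : ℕ) :
        Measurable fun x => ((min (gaussDigit (2 * i) x) (A * 2 ^ j) : ℕ) : ENNReal) :=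
      (measurable_from_nat (f := fun n : ℕ => ((min n (A * 2 ^ j) : ℕ) : ENNReal))).comp
        (measurable_gaussDigit _)
    refine (meas_ge_le_lintegral_div
      (Finset.measurable_fun_sum _ fun i _ => hmeas i).aemeasurable
      (by exact_mod_cast hD.ne') (ENNReal.natCast_ne_top _)).trans ?_
    rw [lintegral_finsetSum _ fun i _ => hmeas i]
    refine (ENNReal.div_le_div_right
      (Finset.sum_le_sum fun i _ => lintegral_min_digit_le (2 * i) _) _).trans ?_
    rw [Finset.sum_const, Finset.card_range, nsmul_eq_mul, ← ENNReal.ofReal_natCast,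
      ← ENNReal.ofReal_natCast (A ^ 2 * (j + 1) * 2 ^ j),
      ← ENNReal.ofReal_mul (by positivity), ← ENNReal.ofReal_div_of_pos (by exact_mod_cast hD)]
    apply ENNReal.ofReal_le_ofReal
    push_cast
    rw [log_mul (by positivity) (by positivity), log_pow,
      div_le_div_iff₀ (by positivity) (by positivity)]
    have hlogA : 1 + log A ≤ A := by linarith [log_le_sub_one_of_pos (show (0 : ℝ) < A by linarith)]
    have hlog2 : (j : ℝ) * log 2 ≤ A * j := by
      have : log 2 ≤ A := by linarith [log_two_lt_d9]
      nlinarith [j.cast_nonneg (α := ℝ)]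
    have : 1 + (log A + j * log 2) ≤ A * (j + 1) := by linarith
    calc 2 ^ j * (2 * (1 + (log A + j * log 2))) * (A : ℝ)
        ≤ 2 ^ j * (2 * (A * (j + 1))) * (A : ℝ) := by gcongr
      _ = _ := by ring
  calc μ _ ≤ _ := (measure_mono hsub).trans ((measure_union_le _ _).trans (add_le_add h1 h2))
    _ = _ := by
      rw [← ENNReal.ofReal_add (by positivity) (by positivity)]
      congr 1
      ring

/-- If the events `B j` have probability at most `ε` and the weights `w j` are not summable, then
the weights over those `j` for which `B j` fails are summable with probability at most `ε`. -/
lemma measure_summable_compl_le {Ω : Type*} [MeasurableSpace Ω] (μ : Measure Ω)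
    {B : ℕ → Set Ω} (hB : ∀ j, MeasurableSet (B j)) {ε : ENNReal} (hε : ∀ j, μ (B j) ≤ ε)
    {w : ℕ → ℝ} (hw : ∀ j, 0 ≤ w j) (hsum : ¬ Summable w) :
    μ {x | Summable fun j => (B j)ᶜ.indicator (fun _ => w j) x} ≤ ε := by
  rw [not_summable_iff_tendsto_nat_atTop_of_nonneg hw] at hsum
  set H : ℕ → ℝ := fun J => ∑ j ∈ Finset.range J, w j with hH
  have hH0 (J : ℕ) : 0 ≤ H J := Finset.sum_nonneg fun j _ => hw j
  set R : ℕ → Ω → ENNReal := fun J x =>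
    ∑ j ∈ Finset.range J, (B j).indicator (fun _ => ENNReal.ofReal (w j / H J)) x with hR
  have hRmeas (J : ℕ) : Measurable (R J) :=
    Finset.measurable_fun_sum _ fun j _ => measurable_const.indicator (hB j)
  have hRint (J : ℕ) : ∫⁻ x, R J x ∂μ ≤ ε := by
    simp only [hR]
    rw [lintegral_finsetSum _ fun j _ => measurable_const.indicator (hB j)]
    simp only [lintegral_indicator_const (hB _)]
    calc _ ≤ ∑ j ∈ Finset.range J, ENNReal.ofReal (w j / H J) * ε := by
          gcongr with j
          exact hε j
      _ = ENNReal.ofReal (H J / H J) * ε := by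
          rw [← Finset.sum_mul, ← ENNReal.ofReal_sum_of_nonneg fun j _ => div_nonneg (hw j) (hH0 J),
            ← Finset.sum_div]
      _ ≤ 1 * ε := by
          gcongr
          rw [← ENNReal.ofReal_one]
          exact ENNReal.ofReal_le_ofReal (div_self_le_one _)
      _ = ε := one_mul _
  have hlim {x : Ω} (hx : Summable fun j => (B j)ᶜ.indicator (fun _ => w j) x) :
      1 ≤ liminf (fun J => R J x) atTop := by
    have h1 : Tendsto (fun J => ENNReal.ofReal
        (1 - (∑ j ∈ Finset.range J, (B j)ᶜ.indicator (fun _ => w j) x) / H J)) atTop (nhds 1) := by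
      rw [← ENNReal.ofReal_one]
      refine ENNReal.tendsto_ofReal ?_
      simpa using (hx.hasSum.tendsto_sum_nat.div_atTop hsum).const_sub 1
    refine (h1.congr' ?_).liminf_eq.ge
    filter_upwards [hsum.eventually_gt_atTop 0] with J hJ
    have h2 : H J - ∑ j ∈ Finset.range J, (B j)ᶜ.indicator (fun _ => w j) x =
        ∑ j ∈ Finset.range J, (B j).indicator (fun _ => w j) x := by
      rw [hH, ← Finset.sum_sub_distrib]
      refine Finset.sum_congr rfl fun j _ => ?_
      by_cases hj : x ∈ B j <;> simp [hj]
    rw [one_sub_div hJ.ne', h2, Finset.sum_div, ENNReal.ofReal_sum_of_nonneg fun j _ =>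
      div_nonneg (Set.indicator_nonneg (fun _ _ => hw j) _) hJ.le]
    refine Finset.sum_congr rfl fun j _ => ?_
    by_cases hj : x ∈ B j <;> simp [hj]
  calc μ _ ≤ μ {x | 1 ≤ liminf (fun J => R J x) atTop} := measure_mono fun x hx => hlim hx
    _ ≤ ∫⁻ x, liminf (fun J => R J x) atTop ∂μ := by
        simpa using mul_meas_ge_le_lintegral (μ := μ) (Measurable.liminf hRmeas) 1
    _ ≤ liminf (fun J => ∫⁻ x, R J x ∂μ) atTop := lintegral_liminf_le hRmeas
    _ ≤ liminf (fun _ => ε) atTop := liminf_le_liminf (Eventually.of_forall hRint)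
    _ = ε := liminf_const _

lemma evenDigitSum_mono (x : ℝ) : Monotone fun k => evenDigitSum k x := fun _ _ h =>
  Finset.sum_le_sum_of_subset (Finset.range_mono h)

lemma one_le_evenDigitSum {x : ℝ} (hx : x ∈ Set.Ioc (0 : ℝ) 1) {k : ℕ} (hk : 0 < k) :
    1 ≤ evenDigitSum k x := by
  refine le_trans ?_ (evenDigitSum_mono x (Nat.one_le_iff_ne_zero.2 hk.ne'))
  change 1 ≤ evenDigitSum (0 + 1) x
  rw [evenDigitSum_succ, evenDigitSum_zero]
  exact (Nat.one_le_floor_iff _).2 ((one_le_inv₀ hx.1).2 hx.2)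

lemma ae_not_summable_evenDigitSum :
    ∀ᵐ x ∂(volume.restrict (Set.Ioo (0 : ℝ) 1)),
      ¬ Summable fun k => (1 : ℝ) / evenDigitSum k x := by
  rw [← Measure.restrict_congr_set Ioo_ae_eq_Ico.symm]
  have hpos : ∀ᵐ x ∂(volume.restrict (Set.Ico (0 : ℝ) 1)), x ∈ Set.Ioo (0 : ℝ) 1 := by
    rw [← Measure.restrict_congr_set Ioo_ae_eq_Ico]
    exact ae_restrict_mem measurableSet_Ioo
  set μ := volume.restrict (Set.Ico (0 : ℝ) 1)
  have hnull : μ {x | x ∈ Set.Ioo (0 : ℝ) 1 ∧ Summable fun k => (1 : ℝ) / evenDigitSum k x} = 0 := by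
    have hle (A : ℕ) (hA : 1 ≤ A) :
        μ {x | x ∈ Set.Ioo (0 : ℝ) 1 ∧ Summable fun k => (1 : ℝ) / evenDigitSum k x} ≤
          ENNReal.ofReal (4 / A) := by
      refine (measure_mono ?_).trans (measure_summable_compl_le μ
        (fun j => measurableSet_lt measurable_const (measurable_evenDigitSum (2 ^ j)))
        (volume_lt_evenDigitSum_le hA) (w := fun j => 1 / ((j : ℝ) + 1)) (fun j => by positivity)
        ?_)
      · rintro x ⟨hx, hs⟩
        have hx' := Set.Ioo_subset_Ioc_self hx
        have hanti : ∀ ⦃m n : ℕ⦄, 0 < m → m ≤ n →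
            (1 : ℝ) / evenDigitSum n x ≤ 1 / evenDigitSum m x := fun m n hm hmn => by
          have := one_le_evenDigitSum hx' hm
          have h2 : (evenDigitSum m x : ℝ) ≤ evenDigitSum n x := by
            exact_mod_cast evenDigitSum_mono x hmn
          have h3 : (0 : ℝ) < evenDigitSum m x := by exact_mod_cast this
          gcongr
        have hs2 := (summable_condensed_iff_of_nonneg (fun n => by positivity) hanti).2 hs
        refine Summable.of_nonneg_of_le
          (fun j => Set.indicator_nonneg (fun _ _ => by positivity) _) (fun j => ?_)
          (hs2.mul_left ((A : ℝ) ^ 2))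
        refine Set.indicator_apply_le' (fun hj => ?_) (fun _ => by positivity)
        have h1 : (0 : ℝ) < evenDigitSum (2 ^ j) x := by
          exact_mod_cast one_le_evenDigitSum hx' (pow_pos two_pos j)
        have h2 : (evenDigitSum (2 ^ j) x : ℝ) ≤ A ^ 2 * (j + 1) * 2 ^ j := by
          exact_mod_cast not_lt.1 (Set.notMem_ofPred_iff.1 hj)
        rw [← mul_assoc, mul_one_div, div_le_div_iff₀ (by positivity) h1]
        linarith
      · intro h
        exact not_summable_one_div_natCast ((summable_nat_add_iff 1).1 (by exact_mod_cast h))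
    have hlim : Tendsto (fun A : ℕ => ENNReal.ofReal (4 / A)) atTop (nhds 0) := by
      rw [← ENNReal.ofReal_zero]
      exact ENNReal.tendsto_ofReal (tendsto_const_div_atTop_nhds_zero_nat 4)
    exact le_antisymm (ge_of_tendsto hlim ((eventually_ge_atTop 1).mono hle)) zero_le
  filter_upwards [hpos, measure_eq_zero_iff_ae_notMem.1 hnull] with x hx hx2 hs
  exact hx2 ⟨hx, hs⟩

lemma gaussMap_mem_Ioo {x : ℝ} (hx : Irrational x) : gaussMap x ∈ Set.Ioo (0 : ℝ) 1 := by
  refine ⟨(Int.fract_nonneg _).lt_of_ne fun h => ?_, Int.fract_lt_one _⟩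
  exact hx.inv.ne_int ⌊x⁻¹⌋ (sub_eq_zero.1 h.symm)

lemma irrational_gaussMap {x : ℝ} (hx : Irrational x) : Irrational (gaussMap x) :=
  hx.inv.sub_intCast _

lemma irrational_iterate_gaussMap {x : ℝ} (hx : Irrational x) (n : ℕ) :
    Irrational (gaussMap^[n] x) :=
  Function.Iterate.rec Irrational hx (fun _ => irrational_gaussMap) n

lemma iterate_gaussMap_mem_Ioo {x : ℝ} (hx : Irrational x) (h01 : x ∈ Set.Ioo (0 : ℝ) 1) :
    ∀ n, gaussMap^[n] x ∈ Set.Ioo (0 : ℝ) 1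
  | 0 => h01
  | n + 1 => by
    rw [Function.iterate_succ_apply']
    exact gaussMap_mem_Ioo (irrational_iterate_gaussMap hx n)

lemma negT_one_sub_inv {u : ℝ} (hu : 1 < u) : negT (1 - u⁻¹) = Int.fract (-(u - 1)⁻¹) := by
  have h1 : u - 1 ≠ 0 := by linarith
  have h2 : -1 / (1 - u⁻¹) = -(u - 1)⁻¹ - 1 := by
    have h3 : 1 - u⁻¹ = (u - 1) / u := by field_simp
    rw [h3]
    field_simp
    ring
  rw [negT, h2, Int.fract_sub_one]

lemma iterate_negT_of_lt {x : ℝ} (h01 : x ∈ Set.Ioo (0 : ℝ) 1) :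
    ∀ i < gaussDigit 0 x, negT^[i] (1 - x) = 1 - (x⁻¹ - i)⁻¹
  | 0, _ => by simp
  | i + 1, hi => by
    have h : ((i + 2 : ℕ) : ℝ) ≤ x⁻¹ := (Nat.le_floor_iff (inv_pos.2 h01.1).le).1 hi
    push_cast at h
    rw [Function.iterate_succ_apply', iterate_negT_of_lt h01 i (by omega),
      negT_one_sub_inv (by linarith), Int.fract_eq_iff]
    push_cast
    rw [sub_sub]
    have h1 : (1 : ℝ) ≤ x⁻¹ - (i + 1) := by linarith
    refine ⟨sub_nonneg.2 (inv_le_one_of_one_le₀ h1), ?_, -1, by push_cast; ring⟩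
    linarith [inv_pos.2 (one_pos.trans_le h1)]

/-- The last of the `gaussDigit 0 x` steps of `negT` that correspond to two steps of the Gauss
map. -/
lemma iterate_negT_pred_digit {x : ℝ} (h01 : x ∈ Set.Ioo (0 : ℝ) 1) :
    negT^[gaussDigit 0 x - 1] (1 - x) = 1 - (1 + gaussMap x)⁻¹ := by
  have h1 : 1 ≤ gaussDigit 0 x := (Nat.one_le_floor_iff _).2 ((one_le_inv₀ h01.1).2 h01.2.le)
  rw [iterate_negT_of_lt h01 _ (by omega)]
  have h2 : gaussMap x = x⁻¹ - gaussDigit 0 x := by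
    rw [gaussMap, Int.fract, ← natCast_floor_eq_intCast_floor (inv_pos.2 h01.1).le]
    rfl
  rw [h2]
  push_cast [h1]
  ring_nf

lemma iterate_negT_digit {x : ℝ} (hx : Irrational x) (h01 : x ∈ Set.Ioo (0 : ℝ) 1) :
    negT^[gaussDigit 0 x] (1 - x) = 1 - gaussMap (gaussMap x) := by
  have h1 : 1 ≤ gaussDigit 0 x := (Nat.one_le_floor_iff _).2 ((one_le_inv₀ h01.1).2 h01.2.le)
  have hg := gaussMap_mem_Ioo hx
  rw [← Nat.sub_add_cancel h1, Function.iterate_succ_apply', iterate_negT_pred_digit h01,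
    negT_one_sub_inv (by linarith [hg.1]), add_sub_cancel_left,
    Int.fract_neg (gaussMap_mem_Ioo (irrational_gaussMap hx)).1.ne', ← gaussMap]

lemma iterate_negT_evenDigitSum {x : ℝ} (hx : Irrational x) (h01 : x ∈ Set.Ioo (0 : ℝ) 1) (k : ℕ) :
    negT^[evenDigitSum k x] (1 - x) = 1 - gaussMap^[2 * k] x := by
  induction k with
  | zero => rfl
  | succ k ih =>
    rw [evenDigitSum, Finset.sum_range_succ, ← evenDigitSum, add_comm, Function.iterate_add_apply,
      ih, mul_add_one, Function.iterate_succ_apply', Function.iterate_succ_apply']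
    exact iterate_negT_digit (irrational_iterate_gaussMap hx _) (iterate_gaussMap_mem_Ioo hx h01 _)

lemma gaussDigit_le_negDigit {x : ℝ} (hx : Irrational x) (h01 : x ∈ Set.Ioo (0 : ℝ) 1) (k : ℕ) :
    gaussDigit (2 * k + 1) x ≤ negDigit x (evenDigitSum (k + 1) x) := by
  have hy := irrational_iterate_gaussMap hx (2 * k)
  have hy01 := iterate_gaussMap_mem_Ioo hx h01 (2 * k)
  have h1 : 1 ≤ gaussDigit (2 * k) x :=
    (Nat.one_le_floor_iff _).2 ((one_le_inv₀ hy01.1).2 hy01.2.le)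
  have h2 : negT^[evenDigitSum (k + 1) x - 1] (1 - x) =
      1 - (1 + gaussMap (gaussMap^[2 * k] x))⁻¹ := by
    rw [evenDigitSum, Finset.sum_range_succ, ← evenDigitSum, Nat.add_sub_assoc h1, add_comm,
      Function.iterate_add_apply, iterate_negT_evenDigitSum hx h01]
    exact iterate_negT_pred_digit hy01
  have hg := (gaussMap_mem_Ioo hy).1
  rw [negDigit, h2, gaussDigit, Function.iterate_succ_apply', Int.ceil_toNat]
  refine (Nat.floor_le_ceil _).trans (Nat.ceil_mono ?_)
  set g := gaussMap (gaussMap^[2 * k] x)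
  have h3 : 1 / (1 - (1 + g)⁻¹) = g⁻¹ + 1 := by
    have h4 : 1 - (1 + g)⁻¹ = g / (1 + g) := by field_simp; ring
    rw [h4]
    field_simp
  linarith

lemma limsup_coe_eq_top_of_forall_exists {u : ℕ → ℝ} (h : ∀ M : ℕ, 1 ≤ M → ∃ n, (M : ℝ) ≤ u n) :
    limsup (fun n => (u n : EReal)) atTop = ⊤ := by
  rw [EReal.eq_top_iff_forall_lt]
  intro y
  have hfreq : ∃ᶠ n in atTop, ((y + 1 : ℝ) : EReal) ≤ u n := by
    rw [frequently_atTop]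
    intro n₀
    obtain ⟨M, hM⟩ := exists_nat_gt (max (y + 1) (∑ i ∈ Finset.range n₀, |u i|))
    have hM0 : (0 : ℝ) < M :=
      (Finset.sum_nonneg fun i _ => abs_nonneg (u i)).trans_lt (max_lt_iff.1 hM).2
    obtain ⟨n, hn⟩ := h M (by exact_mod_cast hM0)
    refine ⟨n, ?_, EReal.coe_le_coe_iff.2 ((max_lt_iff.1 hM).1.le.trans hn)⟩
    by_contra! hlt
    have := Finset.single_le_sum (f := fun i => |u i|) (fun i _ => abs_nonneg _)
      (Finset.mem_range.2 hlt)
    linarith [le_abs_self (u n), (max_lt_iff.1 hM).2]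
  exact (EReal.coe_lt_coe_iff.2 (lt_add_one y)).trans_le (le_limsup_of_frequently_le' hfreq)

/-- For a.e. irrational `x ∈ (0,1)`, the limsup of the arithmetic means of the
negative continued fraction digits is `∞`. -/
theorem negDigit_mean_limsup_eq_top :
    ∀ᵐ x ∂(volume.restrict (Set.Ioo (0 : ℝ) 1)), Irrational x →
      Filter.limsup
        (fun n : ℕ => (((1 / n : ℝ) * ∑ k ∈ Finset.Icc 1 n, (negDigit x k : ℝ) : ℝ) : EReal))
        atTop = ⊤ := by
  have hdigit : ∀ᵐ x ∂(volume.restrict (Set.Ioo (0 : ℝ) 1)), ∀ M : ℕ, 1 ≤ M →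
      (∃ k, M * evenDigitSum (k + 1) x ≤ gaussDigit (2 * k + 1) x) ∨
        Summable fun k => (1 : ℝ) / evenDigitSum k x := by
    rw [Measure.restrict_congr_set Ioo_ae_eq_Ico]
    refine ae_all_iff.2 fun M => ?_
    by_cases hM : 1 ≤ M
    · filter_upwards [ae_exists_digit_ge_or_summable hM] with x hx _ using hx
    · exact Eventually.of_forall fun x h => absurd h hM
  filter_upwards [hdigit, ae_not_summable_evenDigitSum, ae_restrict_mem measurableSet_Ioo]
    with x h1 h2 h01 hx
  refine limsup_coe_eq_top_of_forall_exists fun M hM => ?_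
  obtain ⟨k, hk⟩ := (h1 M hM).resolve_right h2
  have hpos := one_le_evenDigitSum (Set.Ioo_subset_Ioc_self h01) k.succ_pos
  refine ⟨evenDigitSum (k + 1) x, ?_⟩
  have hle : M * evenDigitSum (k + 1) x ≤
      ∑ i ∈ Finset.Icc 1 (evenDigitSum (k + 1) x), negDigit x i :=
    hk.trans ((gaussDigit_le_negDigit hx h01 k).trans
      (Finset.single_le_sum (fun _ _ => Nat.zero_le _) (Finset.mem_Icc.2 ⟨hpos, le_rfl⟩)))
  rw [one_div_mul_eq_div, le_div_iff₀ (by exact_mod_cast hpos)]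
  exact_mod_cast hle
end
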